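/- arXiv:1111.2828 — 10 statements merged into one kernel-verified Lean document; each statement's English description precedes it below -/
import Mathlib

section
/- Let n ≥ 2 and let g_0, g_1, g_2, g_3 ∈ SL(n,ℂ) be such that all Ptolemy coordinates c_t, t ∈ T^3(n), are nonzero (a generic tuple). Then for every α ∈ T^3(n−2), the Ptolemy relations hold: c_{α_{03}}·c_{α_{12}} + c_{α_{01}}·c_{α_{23}} = c_{α_{02}}·c_{α_{13}}. -/
/-- The list of column vectors obtained by taking, in order, the first `t i` columns of
each matrix `g i`. -/
def ptolemyCols {n m : ℕ} (g : Fin m → Matrix (Fin n) (Fin n) ℂ) (t : Fin m → ℕ) :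
    List (Fin n → ℂ) :=
  (List.finRange m).flatMap fun i =>
    (List.range (t i)).map fun j r => if h : j < n then g i r ⟨j, h⟩ else 0

/-- The Ptolemy coordinate of the tuple `(g 0, …, g (m-1))` at `t = (t 0, …, t (m-1))` with
`∑ i, t i = n`: the determinant of the `n × n` matrix whose columns are, in order, the first
`t 0` columns of `g 0`, the first `t 1` columns of `g 1`, …  (Junk value `0` if `∑ i, t i ≠ n`.) -/
noncomputable def ptolemyCoord {n m : ℕ} (g : Fin m → Matrix (Fin n) (Fin n) ℂ)
    (t : Fin m → ℕ) : ℂ :=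
  if ht : (ptolemyCols g t).length = n then
    (Matrix.of fun r c : Fin n => (ptolemyCols g t).get (Fin.cast ht.symm c) r).det
  else 0

/-- `α + e i + e j`, where `e i` is the `i`-th standard basis vector of `ℤ⁴`. -/
def vtx (α : Fin 4 → ℕ) (i j : Fin 4) : Fin 4 → ℕ :=
  fun m => α m + (if m = i then 1 else 0) + (if m = j then 1 else 0)

/-- The three-term Plücker relation for the determinants obtained by completing a fixed family of
`m` vectors in `R^(m+2)` by two vectors. -/
theorem Matrix.det_vecCons_vecCons_pluecker {R : Type*} [CommRing R] {m : ℕ}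
    (W : Fin m → Fin (m + 2) → R) (x₀ x₁ x₂ x₃ : Fin (m + 2) → R) :
    (Matrix.of (Matrix.vecCons x₀ (Matrix.vecCons x₃ W))).det *
          (Matrix.of (Matrix.vecCons x₁ (Matrix.vecCons x₂ W))).det +
        (Matrix.of (Matrix.vecCons x₀ (Matrix.vecCons x₁ W))).det *
          (Matrix.of (Matrix.vecCons x₂ (Matrix.vecCons x₃ W))).det =
      (Matrix.of (Matrix.vecCons x₀ (Matrix.vecCons x₂ W))).det *
        (Matrix.of (Matrix.vecCons x₁ (Matrix.vecCons x₃ W))).det := by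
  set P : (Fin (m + 2) → R) → (Fin (m + 2) → R) → R :=
    fun x y => (Matrix.of (Matrix.vecCons x (Matrix.vecCons y W))).det with hP
  let L : (Fin (m + 2) → R) →ₗ[R] R :=
    (Matrix.detRowAlternating (n := Fin (m + 2)) (R := R)).toMultilinearMap.toLinearMap
      (Matrix.vecCons 0 (Matrix.vecCons x₃ W)) 0
  have hL : ∀ x, L x = P x x₃ := by
    intro x
    have : Function.update (Matrix.vecCons 0 (Matrix.vecCons x₃ W)) 0 x =
        Matrix.vecCons x (Matrix.vecCons x₃ W) := by
      simp [Matrix.vecCons]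
    simp only [L, hP, MultilinearMap.toLinearMap_apply, this]
    rfl
  have hLW : ∀ i, L (W i) = 0 := by
    intro i
    rw [hL]
    refine Matrix.det_zero_of_row_eq (i := 0) (j := i.succ.succ) (Fin.succ_ne_zero _).symm ?_
    rfl
  set A : Matrix (Fin (m + 2)) (Fin (m + 2)) R :=
    Matrix.of (Matrix.vecCons x₀ (Matrix.vecCons x₁ W))
  have hcr : A.det • x₂ = ∑ i, (A.updateRow i x₂).det • A i := by
    have h := Matrix.mulVec_cramer A.transpose x₂
    rw [Matrix.det_transpose] at h
    rw [← h]
    ext j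
    simp [Matrix.mulVec, dotProduct, Matrix.cramer_transpose_apply, mul_comm]
  have h0 : A.updateRow 0 x₂ = Matrix.of (Matrix.vecCons x₂ (Matrix.vecCons x₁ W)) := by
    ext i j
    refine Fin.cases ?_ (fun i => ?_) i <;> simp [A, Matrix.updateRow_apply]
  have h1 : A.updateRow 1 x₂ = Matrix.of (Matrix.vecCons x₀ (Matrix.vecCons x₂ W)) := by
    ext i j
    refine Fin.cases ?_ (fun i => Fin.cases ?_ (fun i => ?_) i) i <;>
      simp [A, Matrix.updateRow_apply, Fin.ext_iff]
  have hswap : P x₂ x₁ = -P x₁ x₂ := by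
    have h := (Matrix.detRowAlternating (n := Fin (m + 2)) (R := R)).map_swap
      (Matrix.vecCons x₁ (Matrix.vecCons x₂ W)) (i := 0) (j := 1) (by simp)
    have e : Matrix.vecCons x₁ (Matrix.vecCons x₂ W) ∘ Equiv.swap (0 : Fin (m + 2)) 1 =
        Matrix.vecCons x₂ (Matrix.vecCons x₁ W) := by
      ext i j
      refine Fin.cases ?_ (fun i => Fin.cases ?_ (fun i => ?_) i) i
      · simp
      · simp
      · have : Equiv.swap (0 : Fin (m + 2)) 1 i.succ.succ = i.succ.succ :=
          Equiv.swap_apply_of_ne_of_ne (Fin.succ_ne_zero _)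
            (fun h => Fin.succ_ne_zero i (Fin.succ_injective _ h))
        simp [this]
    rw [e] at h
    exact h
  have key := congrArg L hcr
  rw [map_smul, map_sum, Fin.sum_univ_succ, Fin.sum_univ_succ] at key
  have hrest : ∀ i : Fin m, L ((A.updateRow i.succ.succ x₂).det • A i.succ.succ) = 0 := by
    intro i
    rw [map_smul]
    have : A i.succ.succ = W i := rfl
    rw [this, hLW, smul_zero]
  rw [Finset.sum_eq_zero fun i _ => hrest i, map_smul, map_smul, Fin.succ_zero_eq_one, h0, h1,
    show A 0 = x₀ from rfl, show A 1 = x₁ from rfl, hL, hL, hL] at key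
  change P x₀ x₁ * P x₂ x₃ = P x₂ x₁ * P x₀ x₃ + (P x₀ x₂ * P x₁ x₃ + 0) at key
  rw [hswap] at key
  change P x₀ x₃ * P x₁ x₂ + P x₀ x₁ * P x₂ x₃ = P x₀ x₂ * P x₁ x₃
  linear_combination key

/-- The determinant of the matrix whose rows are the first `n` vectors of a list, padded by `0`. -/
def listDet {R : Type*} [CommRing R] (n : ℕ) (L : List (Fin n → R)) : R :=
  Matrix.detRowAlternating fun i : Fin n => L.getD i 0

theorem listDet_swap {R : Type*} [CommRing R] {n : ℕ} (A B : List (Fin n → R)) (x y : Fin n → R)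
    (h : A.length + 1 < n) :
    listDet n (A ++ x :: y :: B) = -listDet n (A ++ y :: x :: B) := by
  have hs := (Matrix.detRowAlternating (n := Fin n) (R := R)).map_swap
    (fun i : Fin n => (A ++ y :: x :: B).getD i 0)
    (i := ⟨A.length, by omega⟩) (j := ⟨A.length + 1, h⟩) (by simp)
  have e : (fun i : Fin n => (A ++ y :: x :: B).getD i 0) ∘
      Equiv.swap (⟨A.length, by omega⟩ : Fin n) ⟨A.length + 1, h⟩ =
      fun i : Fin n => (A ++ x :: y :: B).getD i 0 := by
    funext ⟨i, hi⟩
    simp only [Function.comp, Equiv.swap_apply_def, Fin.mk.injEq]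
    split_ifs with h1 h2
    · subst h1
      simp [List.getD]
    · subst h2
      simp [List.getD]
    · rcases lt_or_ge i A.length with h3 | h3
      · simp [List.getD, List.getElem?_append_left h3]
      · obtain ⟨k, rfl⟩ : ∃ k, i = A.length + 2 + k := ⟨i - (A.length + 2), by omega⟩
        have h4 : A.length + 2 + k - A.length = k + 2 := by omega
        simp [List.getD, List.getElem?_append_right h3, h4]
  rw [e] at hs
  exact hs

theorem listDet_move {R : Type*} [CommRing R] {n : ℕ} (B : List (Fin n → R)) :
    ∀ (A C : List (Fin n → R)) (x : Fin n → R), A.length + B.length < n →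
      listDet n (A ++ (B ++ x :: C)) = (-1) ^ B.length * listDet n (A ++ x :: (B ++ C)) := by
  induction B with
  | nil => simp
  | cons b B ih =>
    intro A C x h
    simp only [List.length_cons] at h
    have h1 := ih (A ++ [b]) C x (by simp; omega)
    simp only [List.append_assoc, List.singleton_append] at h1
    rw [List.cons_append, h1, listDet_swap A (B ++ C) b x (by omega), List.length_cons, pow_succ,
      List.cons_append]
    ring

theorem listDet_cons_cons {R : Type*} [CommRing R] {m : ℕ} (x y : Fin (m + 2) → R)
    (W : List (Fin (m + 2) → R)) :
    listDet (m + 2) (x :: y :: W) =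
      (Matrix.of (Matrix.vecCons x (Matrix.vecCons y fun i : Fin m => W.getD i 0))).det := by
  refine congrArg Matrix.detRowAlternating ?_
  funext i
  refine Fin.cases ?_ (fun i => Fin.cases ?_ (fun i => ?_) i) i <;> rfl

/-- Moving two vectors of a list to the front. -/
theorem listDet_move_two {R : Type*} [CommRing R] {n : ℕ} (A B C : List (Fin n → R))
    (x y : Fin n → R) (h : A.length + B.length + 2 ≤ n) :
    listDet n (A ++ (x :: (B ++ y :: C))) =
      (-1) ^ A.length * (-1) ^ (A ++ B).length * listDet n (x :: y :: (A ++ B ++ C)) := by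
  have h1 := listDet_move A [] (B ++ y :: C) x (by simp; omega)
  have h2 := listDet_move (A ++ B) [x] C y (by simp; omega)
  simp only [List.nil_append, List.singleton_append, List.append_assoc] at h1 h2
  rw [h1, h2]
  simp only [List.append_assoc]
  ring

theorem ptolemyCoord_eq_listDet {n m : ℕ} (g : Fin m → Matrix (Fin n) (Fin n) ℂ) (t : Fin m → ℕ)
    (h : (ptolemyCols g t).length = n) : ptolemyCoord g t = listDet n (ptolemyCols g t) := by
  rw [ptolemyCoord, dif_pos h, ← Matrix.det_transpose, listDet]
  refine congrArg Matrix.detRowAlternating ?_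
  funext i j
  have : (i : ℕ) < (ptolemyCols g t).length := by omega
  simp [Matrix.transpose_apply, List.getD, this]

theorem length_ptolemyCols {n m : ℕ} (g : Fin m → Matrix (Fin n) (Fin n) ℂ) (t : Fin m → ℕ) :
    (ptolemyCols g t).length = ∑ i, t i := by
  simp [ptolemyCols, List.length_flatMap, Fin.sum_univ_def]

theorem sum_vtx (α : Fin 4 → ℕ) (i j : Fin 4) : ∑ k, vtx α i j k = ∑ k, α k + 2 := by
  simp [vtx, Finset.sum_add_distrib]

/-- for a generic tuple `(g 0, g 1, g 2, g 3)` in `SL(n, ℂ)` (all Ptolemy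
coordinates nonzero), the Ptolemy relations
`c_{α₀₃} c_{α₁₂} + c_{α₀₁} c_{α₂₃} = c_{α₀₂} c_{α₁₃}` hold for every `α ∈ T³(n-2)`. -/
theorem ptolemy_relations_of_generic (n : ℕ) (hn : 2 ≤ n)
    (g : Fin 4 → Matrix.SpecialLinearGroup (Fin n) ℂ)
    (hgen : ∀ t : Fin 4 → ℕ, ∑ i, t i = n →
      ptolemyCoord (fun i => (g i : Matrix (Fin n) (Fin n) ℂ)) t ≠ 0) :
    ∀ α : Fin 4 → ℕ, (∑ i, α i) + 2 = n →
      ptolemyCoord (fun i => (g i : Matrix (Fin n) (Fin n) ℂ)) (vtx α 0 3) *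
          ptolemyCoord (fun i => (g i : Matrix (Fin n) (Fin n) ℂ)) (vtx α 1 2) +
        ptolemyCoord (fun i => (g i : Matrix (Fin n) (Fin n) ℂ)) (vtx α 0 1) *
          ptolemyCoord (fun i => (g i : Matrix (Fin n) (Fin n) ℂ)) (vtx α 2 3) =
      ptolemyCoord (fun i => (g i : Matrix (Fin n) (Fin n) ℂ)) (vtx α 0 2) *
        ptolemyCoord (fun i => (g i : Matrix (Fin n) (Fin n) ℂ)) (vtx α 1 3) := by
  rintro α rfl
  set G : Fin 4 → Matrix (Fin (∑ i, α i + 2)) (Fin (∑ i, α i + 2)) ℂ := fun i => (g i).1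
  have hc : ∀ i j, ptolemyCoord G (vtx α i j) = listDet _ (ptolemyCols G (vtx α i j)) :=
    fun i j => ptolemyCoord_eq_listDet _ _ (by rw [length_ptolemyCols, sum_vtx])
  let f : Fin 4 → ℕ → Fin (∑ i, α i + 2) → ℂ := fun i j r =>
    if h : j < ∑ i, α i + 2 then G i r ⟨j, h⟩ else 0
  have hcols : ∀ t : Fin 4 → ℕ, ptolemyCols G t = (List.range (t 0)).map (f 0) ++
      ((List.range (t 1)).map (f 1) ++ ((List.range (t 2)).map (f 2) ++
        (List.range (t 3)).map (f 3))) := by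
    intro t
    simp [ptolemyCols, List.finRange_succ, f]
  simp only [hc, hcols]
  have hs : α 0 + α 1 + α 2 + α 3 = ∑ i, α i := by simp [Fin.sum_univ_four]
  generalize hN : ∑ i, α i = N at *
  set B : Fin 4 → List (Fin (N + 2) → ℂ) := fun i => (List.range (α i)).map (f i) with hB
  have hlen : ∀ i, (B i).length = α i := by simp [hB]
  have hB0 : ∀ i, (List.range (α i)).map (f i) = B i := fun _ => rfl
  have hB1 : ∀ i, (List.range (α i + 1)).map (f i) = B i ++ [f i (α i)] := by
    simp [hB, List.range_succ]
  have h01 := listDet_move_two (B 0) (B 1) (B 2 ++ B 3) (f 0 (α 0)) (f 1 (α 1))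
    (by simp only [hlen]; omega)
  have h02 := listDet_move_two (B 0) (B 1 ++ B 2) (B 3) (f 0 (α 0)) (f 2 (α 2))
    (by simp only [hlen, List.length_append]; omega)
  have h03 := listDet_move_two (B 0) (B 1 ++ B 2 ++ B 3) [] (f 0 (α 0)) (f 3 (α 3))
    (by simp only [hlen, List.length_append]; omega)
  have h12 := listDet_move_two (B 0 ++ B 1) (B 2) (B 3) (f 1 (α 1)) (f 2 (α 2))
    (by simp only [hlen, List.length_append]; omega)
  have h13 := listDet_move_two (B 0 ++ B 1) (B 2 ++ B 3) [] (f 1 (α 1)) (f 3 (α 3))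
    (by simp only [hlen, List.length_append]; omega)
  have h23 := listDet_move_two (B 0 ++ B 1 ++ B 2) (B 3) [] (f 2 (α 2)) (f 3 (α 3))
    (by simp only [hlen, List.length_append]; omega)
  have hpl := Matrix.det_vecCons_vecCons_pluecker
    (fun i : Fin N => (B 0 ++ (B 1 ++ (B 2 ++ B 3))).getD i 0)
    (f 0 (α 0)) (f 1 (α 1)) (f 2 (α 2)) (f 3 (α 3))
  simp only [← listDet_cons_cons] at hpl
  simp only [List.append_assoc, List.append_nil, List.length_append, hlen] at h01 h02 h03 h12 h13 h23
  simp [vtx, hB0, hB1, h01, h02, h03, h12, h13, h23, -mul_eq_mul_left_iff]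
  linear_combination (-1) ^ α 0 * (-1) ^ (α 0 + α 1) * (-1) ^ (α 0 + (α 1 + α 2)) *
    (-1) ^ (α 0 + (α 1 + (α 2 + α 3))) * hpl
end

section
/- Let A be an n×n matrix over ℂ and let I, J be subsets of {1,…,n} with |I| = |J| = r ≥ 1. Then the minor of the adjugate matrix satisfies |Adj(A)|_{I,J} = (−1)^{Σ(I,J)} · det(A)^{r−1} · |A|_{J^c, I^c}, where Σ(I,J) is the sum of all indices occurring in I and in J (Jacobi's identity for minors of the adjugate). -/
/-- The minor `|A|_{I,J}` of a square matrix: the determinant of the submatrix of `A` with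
rows indexed by `I` and columns indexed by `J`, both taken in increasing order.
(Junk value `0` if `I` and `J` do not have the same cardinality.) -/
noncomputable def minor {n : ℕ} (A : Matrix (Fin n) (Fin n) ℂ) (I J : Finset (Fin n)) : ℂ :=
  if h : J.card = I.card then
    (A.submatrix (I.orderEmbOfFin rfl) (J.orderEmbOfFin h)).det
  else 0

namespace Matrix

variable {m k n R : Type*} [Fintype m] [DecidableEq m] [Fintype k] [DecidableEq k]
  [Fintype n] [DecidableEq n] [CommRing R]

theorem det_submatrix_equiv_equiv (A : Matrix n n R) (e f : m ≃ n) :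
    (A.submatrix f e).det = (Equiv.Perm.sign (e.symm.trans f) : ℤ) * A.det := by
  rw [← det_permute, ← det_submatrix_equiv_self e]
  congr 1
  ext i j
  simp

theorem det_submatrix_mul_det_submatrix_adjugate (A : Matrix n n R) (e f : m ⊕ k ≃ n) :
    (A.submatrix f e).det * (A.adjugate.submatrix (e ∘ Sum.inl) (f ∘ Sum.inl)).det =
      A.det ^ Fintype.card m * (A.submatrix (f ∘ Sum.inr) (e ∘ Sum.inr)).det := by
  have hmul : A.submatrix f e * A.adjugate.submatrix e f =
      A.det • (1 : Matrix (m ⊕ k) (m ⊕ k) R) := by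
    rw [submatrix_mul_equiv, mul_adjugate, submatrix_smul, Pi.smul_apply, Pi.smul_apply,
      submatrix_one_equiv]
  set B := A.submatrix f e with hB
  set C := A.adjugate.submatrix e f with hC
  have h11 : B.toBlocks₁₁ * C.toBlocks₁₁ + B.toBlocks₁₂ * C.toBlocks₂₁ = A.det • 1 := by
    have := congrArg toBlocks₁₁ hmul
    rw [← fromBlocks_toBlocks B, ← fromBlocks_toBlocks C, fromBlocks_multiply,
      ← fromBlocks_one, fromBlocks_smul] at this
    simpa using this
  have h21 : B.toBlocks₂₁ * C.toBlocks₁₁ + B.toBlocks₂₂ * C.toBlocks₂₁ = 0 := by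
    have := congrArg toBlocks₂₁ hmul
    rw [← fromBlocks_toBlocks B, ← fromBlocks_toBlocks C, fromBlocks_multiply,
      ← fromBlocks_one, fromBlocks_smul] at this
    simpa using this
  have hprod : B * fromBlocks C.toBlocks₁₁ 0 C.toBlocks₂₁ 1 =
      fromBlocks (A.det • 1) B.toBlocks₁₂ 0 B.toBlocks₂₂ := by
    conv_lhs => rw [← fromBlocks_toBlocks B]
    rw [fromBlocks_multiply, h11, h21]
    simp
  have hdet := congrArg det hprod
  rw [det_mul, det_fromBlocks_zero₁₂, det_fromBlocks_zero₂₁, det_one, mul_one, det_smul, det_one,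
    mul_one] at hdet
  exact hdet

/-- Jacobi's identity for complementary minors, with the rows and columns enumerated by
arbitrary equivalences. -/
theorem det_submatrix_adjugate [Nonempty m] (A : Matrix n n R) (e f : m ⊕ k ≃ n) :
    (A.adjugate.submatrix (e ∘ Sum.inl) (f ∘ Sum.inl)).det =
      (Equiv.Perm.sign (e.symm.trans f) : ℤ) * A.det ^ (Fintype.card m - 1) *
        (A.submatrix (f ∘ Sum.inr) (e ∘ Sum.inr)).det := by
  suffices h : ∀ X : Matrix n n (MvPolynomial (n × n) ℤ), X = mvPolynomialX n n ℤ →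
      (X.adjugate.submatrix (e ∘ Sum.inl) (f ∘ Sum.inl)).det =
      (Equiv.Perm.sign (e.symm.trans f) : ℤ) * X.det ^ (Fintype.card m - 1) *
        (X.submatrix (f ∘ Sum.inr) (e ∘ Sum.inr)).det by
    have := congrArg (MvPolynomial.aeval fun p : n × n ↦ A p.1 p.2) (h _ rfl)
    simp only [map_mul, map_pow, AlgHom.map_det, map_intCast, AlgHom.mapMatrix_apply,
      ← submatrix_map] at this
    simpa only [← AlgHom.mapMatrix_apply, AlgHom.map_adjugate, mvPolynomialX_mapMatrix_aeval]
      using this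
  intro X hX
  have hX0 : X.det ≠ 0 := hX ▸ det_mvPolynomialX_ne_zero n ℤ
  have key := det_submatrix_mul_det_submatrix_adjugate X e f
  rw [det_submatrix_equiv_equiv] at key
  have hsign : ((Equiv.Perm.sign (e.symm.trans f) : ℤ) : MvPolynomial (n × n) ℤ) *
      (Equiv.Perm.sign (e.symm.trans f) : ℤ) = 1 := by
    rw [← Int.cast_mul, ← Units.val_mul, Int.units_mul_self, Units.val_one, Int.cast_one]
  apply mul_left_cancel₀ hX0
  rw [← Nat.sub_add_cancel (Fintype.card_pos (α := m)), pow_succ] at key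
  linear_combination (Equiv.Perm.sign (e.symm.trans f) : ℤ) * key -
    X.det * (X.adjugate.submatrix (e ∘ Sum.inl) (f ∘ Sum.inl)).det * hsign

end Matrix

theorem Finset.prod_eq_prod_orderEmbOfFin {α M : Type*} [LinearOrder α] [CommMonoid M]
    (s : Finset α) {r : ℕ} (h : s.card = r) (g : α → M) :
    ∏ x ∈ s, g x = ∏ i, g (s.orderEmbOfFin h i) := by
  conv_lhs => rw [← s.map_orderEmbOfFin_univ h, Finset.prod_map]
  rfl

theorem prod_prod_ite_neg_one_mul_self (r : ℕ) :
    (∏ i : Fin r, ∏ j : Fin r, if j < i then (-1 : ℤ) else 1) *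
      (∏ i : Fin r, ∏ j : Fin r, if j < i then (-1 : ℤ) else 1) = 1 := by
  simp only [← Finset.prod_mul_distrib]
  exact Finset.prod_eq_one fun i _ ↦ Finset.prod_eq_one fun j _ ↦ by split_ifs <;> rfl

/-- The permutation listing the elements of `s` and then those of `sᶜ`, both increasingly, has
sign `(-1) ^ ∑ i ∈ s, i`, up to a factor depending only on the cardinality of `s`. -/
theorem sign_finSumEquivOfFinset {r t : ℕ} (s : Finset (Fin (r + t))) (hs : s.card = r)
    (hsc : sᶜ.card = t) :
    (Equiv.Perm.sign (finSumFinEquiv.symm.trans (finSumEquivOfFinset hs hsc)) : ℤ) =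
      (∏ i : Fin r, ∏ j : Fin r, if j < i then -1 else 1) * (-1) ^ ∑ i ∈ s, (i : ℕ) := by
  have hsign : (Equiv.Perm.sign (finSumFinEquiv.symm.trans (finSumEquivOfFinset hs hsc)) : ℤ) =
      ∏ i ∈ s, ∏ j ∈ sᶜ, if j < i then -1 else 1 := by
    rw [Equiv.Perm.sign_eq_prod_prod_Ioi]
    have hIoi (g : Fin (r + t) → Fin (r + t) → ℤ) :
        ∏ i, ∏ j ∈ Finset.Ioi i, g i j = ∏ i, ∏ j, if i < j then g i j else 1 := by
      refine Finset.prod_congr rfl fun i _ ↦ ?_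
      rw [← Finset.prod_filter]
      congr 1
      ext j
      simp
    have hlt (i j : Fin r) : Fin.castAdd t i < Fin.castAdd t j ↔ i < j := Iff.rfl
    have hnlt (i : Fin t) (j : Fin r) : ¬ Fin.natAdd r i < Fin.castAdd t j := by
      simp only [Fin.lt_def, Fin.val_natAdd, Fin.val_castAdd]; omega
    have hlt' (i : Fin r) (j : Fin t) : Fin.castAdd t i < Fin.natAdd r j := by
      simp only [Fin.lt_def, Fin.val_natAdd, Fin.val_castAdd]; omega
    have hcast (p : Prop) [Decidable p] : ((if p then 1 else -1 : ℤˣ) : ℤ) = if p then 1 else -1 := by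
      split_ifs <;> rfl
    simp only [Units.coe_prod, hcast]
    rw [hIoi]
    simp only [Fin.prod_univ_add, Equiv.trans_apply, finSumFinEquiv_symm_apply_castAdd,
      finSumFinEquiv_symm_apply_natAdd, finSumEquivOfFinset_inl, finSumEquivOfFinset_inr,
      OrderEmbedding.lt_iff_lt, hlt, hnlt, hlt', Fin.natAdd_lt_natAdd_iff, if_true, if_false]
    rw [Finset.prod_eq_prod_orderEmbOfFin s hs]
    simp only [Finset.prod_eq_prod_orderEmbOfFin sᶜ hsc]
    have hone (p : Prop) [Decidable p] : (if p then (if p then 1 else -1) else 1 : ℤ) = 1 := by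
      split_ifs <;> rfl
    have hne (i : Fin r) (j : Fin t) :
        (if s.orderEmbOfFin hs i < sᶜ.orderEmbOfFin hsc j then (1 : ℤ) else -1) =
        if sᶜ.orderEmbOfFin hsc j < s.orderEmbOfFin hs i then -1 else 1 := by
      have h1 := s.orderEmbOfFin_mem hs i
      have h2 := Finset.mem_compl.1 (sᶜ.orderEmbOfFin_mem hsc j)
      grind
    simp [hone, hne]
  have hss : (∏ i ∈ s, ∏ j ∈ s, if j < i then (-1 : ℤ) else 1) =
      ∏ i : Fin r, ∏ j : Fin r, if j < i then -1 else 1 := by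
    simp only [Finset.prod_eq_prod_orderEmbOfFin s hs, OrderEmbedding.lt_iff_lt]
  have hall : (∏ i ∈ s, ∏ j ∈ s, if j < i then (-1 : ℤ) else 1) *
      (∏ i ∈ s, ∏ j ∈ sᶜ, if j < i then (-1 : ℤ) else 1) = (-1) ^ ∑ i ∈ s, (i : ℕ) := by
    rw [← Finset.prod_mul_distrib, ← Finset.prod_pow_eq_pow_sum]
    refine Finset.prod_congr rfl fun i _ ↦ ?_
    rw [Finset.prod_mul_prod_compl, ← Finset.prod_filter, Finset.prod_const]
    congr 1
    have : Finset.univ.filter (· < i) = Finset.Iio i := by ext; simp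
    rw [this, Fin.card_Iio]
  rw [hsign, ← hall, hss, ← mul_assoc, prod_prod_ite_neg_one_mul_self, one_mul]

theorem sign_finSumEquivOfFinset_symm_trans {n r t : ℕ} (I J : Finset (Fin n)) (hI : I.card = r)
    (hIc : Iᶜ.card = t) (hJ : J.card = r) (hJc : Jᶜ.card = t) :
    (Equiv.Perm.sign ((finSumEquivOfFinset hI hIc).symm.trans (finSumEquivOfFinset hJ hJc)) : ℤ) =
      (-1) ^ (∑ i ∈ I, (i : ℕ) + ∑ j ∈ J, (j : ℕ)) := by
  obtain rfl : n = r + t := by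
    rw [← hI, ← hIc, Finset.card_add_card_compl, Fintype.card_fin]
  have hcomp : (finSumEquivOfFinset hI hIc).symm.trans (finSumEquivOfFinset hJ hJc) =
      (finSumFinEquiv.symm.trans (finSumEquivOfFinset hI hIc)).symm.trans
        (finSumFinEquiv.symm.trans (finSumEquivOfFinset hJ hJc)) := by
    ext x
    simp
  rw [hcomp, Equiv.Perm.sign_trans, Equiv.Perm.sign_symm, Units.val_mul,
    sign_finSumEquivOfFinset, sign_finSumEquivOfFinset, pow_add]
  linear_combination (-1) ^ (∑ i ∈ I, (i : ℕ)) * (-1) ^ (∑ j ∈ J, (j : ℕ)) *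
    prod_prod_ite_neg_one_mul_self r

/-- Jacobi's identity for minors of the adjugate: for an `n × n` complex
matrix `A` and index sets `I, J ⊆ {1, …, n}` with `|I| = |J| = r ≥ 1`,
`|Adj(A)|_{I,J} = (−1)^{Σ(I,J)} · det(A)^{r−1} · |A|_{Jᶜ,Iᶜ}`, where `Σ(I,J)` is the sum of
the (1-based) indices occurring in `I` and in `J`.  (Here the index `i : Fin n` corresponds
to the 1-based index `i + 1`.) -/
theorem jacobi_identity (n r : ℕ) (hr : 1 ≤ r) (A : Matrix (Fin n) (Fin n) ℂ)
    (I J : Finset (Fin n)) (hI : I.card = r) (hJ : J.card = r) :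
    minor A.adjugate I J =
      (-1 : ℂ) ^ ((∑ i ∈ I, ((i : ℕ) + 1)) + ∑ j ∈ J, ((j : ℕ) + 1)) *
        A.det ^ (r - 1) * minor A Jᶜ Iᶜ := by
  subst hI
  have hIc : Iᶜ.card = Jᶜ.card := by rw [Finset.card_compl, Finset.card_compl, hJ]
  have : Nonempty (Fin I.card) := ⟨⟨0, hr⟩⟩
  have hexp : (-1 : ℂ) ^ ((∑ i ∈ I, ((i : ℕ) + 1)) + ∑ j ∈ J, ((j : ℕ) + 1)) =
      (-1) ^ (∑ i ∈ I, (i : ℕ) + ∑ j ∈ J, (j : ℕ)) := by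
    rw [Finset.sum_add_distrib, Finset.sum_add_distrib, ← Finset.card_eq_sum_ones,
      ← Finset.card_eq_sum_ones, hJ, add_add_add_comm, pow_add _ _ (I.card + I.card),
      Even.neg_one_pow ⟨_, rfl⟩, mul_one]
  have key := Matrix.det_submatrix_adjugate A (finSumEquivOfFinset (rfl : I.card = I.card) hIc)
    (finSumEquivOfFinset hJ rfl)
  rw [sign_finSumEquivOfFinset_symm_trans, Fintype.card_fin] at key
  push_cast at key
  rw [minor, minor, dif_pos hJ, dif_pos hIc, hexp]
  exact key
end

section
/- Let A ∈ GL(n,ℂ) be generic, and let x, y be the unique upper unitriangular matrices such that q = x^{−1} A y is counter-diagonal. Then the counter-diagonal entries of q are given by q_{n,1} = A_{n,1} and, for 1 < j ≤ n, q_{n−j+1,j} = (−1)^{j−1} |A|_{{n−j+1,…,n},{1,…,j}} / |A|_{{n−j+2,…,n},{1,…,j−1}}. -/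
/-- A matrix is generic if for every `k ∈ {1, …, n}` (here `k` is 0-based, `k ∈ {0, …, n-1}`)
the minor with rows `{k, …, n-1}` and columns `{0, …, n-1-k}` is nonzero. -/
def IsGeneric {n : ℕ} (A : Matrix (Fin n) (Fin n) ℂ) : Prop :=
  ∀ k : ℕ, k < n →
    minor A (Finset.univ.filter fun i : Fin n => k ≤ (i : ℕ))
      (Finset.univ.filter fun j : Fin n => (j : ℕ) < n - k) ≠ 0

/-- An upper triangular matrix with `1`'s on the diagonal. -/
def IsUnitriangular {n : ℕ} (x : Matrix (Fin n) (Fin n) ℂ) : Prop :=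
  (∀ i, x i i = 1) ∧ ∀ i j : Fin n, j < i → x i j = 0

/-- A matrix `q` is counter-diagonal if `q i j = 0` unless `i + j = n - 1`
(1-based: unless `j = n - i + 1`). -/
def IsCounterDiag {n : ℕ} (q : Matrix (Fin n) (Fin n) ℂ) : Prop :=
  ∀ i j : Fin n, (i : ℕ) + (j : ℕ) ≠ n - 1 → q i j = 0

/-- A matrix `L` is lower counter-triangular if `L i j = 0` whenever `i + j > n - 1`
(1-based: whenever `j > n - i + 1`). -/
def IsLowerCounterTriangular {n : ℕ} (L : Matrix (Fin n) (Fin n) ℂ) : Prop :=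
  ∀ i j : Fin n, n - 1 < (i : ℕ) + (j : ℕ) → L i j = 0

theorem minor_eq_det_submatrix {n m : ℕ} (A : Matrix (Fin n) (Fin n) ℂ) (I J : Finset (Fin n))
    (f g : Fin m → Fin n) (hf : StrictMono f) (hg : StrictMono g)
    (hI : Finset.univ.image f = I) (hJ : Finset.univ.image g = J) :
    minor A I J = (A.submatrix f g).det := by
  have hIm : I.card = m := by
    rw [← hI, Finset.card_image_of_injective _ hf.injective, Finset.card_fin]
  have hJm : J.card = m := by
    rw [← hJ, Finset.card_image_of_injective _ hg.injective, Finset.card_fin]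
  subst hIm
  have hf' : f = I.orderEmbOfFin rfl :=
    Finset.orderEmbOfFin_unique rfl
      (fun i => hI ▸ Finset.mem_image_of_mem f (Finset.mem_univ i)) hf
  have hg' : g = J.orderEmbOfFin hJm :=
    Finset.orderEmbOfFin_unique hJm
      (fun i => hJ ▸ Finset.mem_image_of_mem g (Finset.mem_univ i)) hg
  rw [minor, dif_pos hJm, ← hf', ← hg']

/-- The increasing enumeration of the last `j` indices of `Fin n`. -/
def lastIndices {n j : ℕ} (h : j ≤ n) (i : Fin j) : Fin n := ⟨n - j + i, by omega⟩

theorem lastIndices_strictMono {n j : ℕ} (h : j ≤ n) : StrictMono (lastIndices h) := by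
  intro a b hab
  exact Nat.add_lt_add_left hab _

theorem mem_range_lastIndices {n j : ℕ} (h : j ≤ n) {i : Fin n} (hi : n - j ≤ (i : ℕ)) :
    i ∈ Set.range (lastIndices h) :=
  ⟨⟨i - (n - j), by omega⟩, Fin.ext (by simp only [lastIndices]; omega)⟩

theorem minor_lowerLeft {n j : ℕ} (h : j ≤ n) (A : Matrix (Fin n) (Fin n) ℂ) {k : ℕ}
    (hk : k = n - j) :
    minor A (Finset.univ.filter fun r : Fin n => k ≤ (r : ℕ))
      (Finset.univ.filter fun c : Fin n => (c : ℕ) < j) =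
      (A.submatrix (lastIndices h) (Fin.castLE h)).det := by
  subst hk
  refine minor_eq_det_submatrix A _ _ _ _ (lastIndices_strictMono h)
    (Fin.strictMono_castLE h) ?_ ?_
  · ext i
    simp only [Finset.mem_image, Finset.mem_univ, true_and, Finset.mem_filter]
    constructor
    · rintro ⟨a, rfl⟩
      simp [lastIndices]
    · exact fun hi => mem_range_lastIndices h hi
  · ext i
    simp only [Finset.mem_image, Finset.mem_univ, true_and, Finset.mem_filter]
    constructor
    · rintro ⟨a, rfl⟩
      simp
    · exact fun hi => ⟨⟨i, hi⟩, rfl⟩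

theorem IsUnitriangular.det_submatrix {n m : ℕ} {x : Matrix (Fin n) (Fin n) ℂ}
    (hx : IsUnitriangular x) {f : Fin m → Fin n} (hf : StrictMono f) :
    (x.submatrix f f).det = 1 := by
  rw [Matrix.det_of_isUpperTriangular]
  · simp [hx.1]
  · exact fun i j hij => hx.2 _ _ (hf hij)

theorem IsUnitriangular.det {n : ℕ} {x : Matrix (Fin n) (Fin n) ℂ}
    (hx : IsUnitriangular x) : x.det = 1 := by
  simpa using hx.det_submatrix strictMono_id

theorem det_lowerLeft_mul_unitriangular {n j : ℕ} (h : j ≤ n) (A : Matrix (Fin n) (Fin n) ℂ)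
    {y : Matrix (Fin n) (Fin n) ℂ} (hy : IsUnitriangular y) :
    ((A * y).submatrix (lastIndices h) (Fin.castLE h)).det =
      (A.submatrix (lastIndices h) (Fin.castLE h)).det := by
  have : (A * y).submatrix (lastIndices h) (Fin.castLE h) =
      A.submatrix (lastIndices h) (Fin.castLE h) *
        y.submatrix (Fin.castLE h) (Fin.castLE h) := by
    ext a b
    simp only [Matrix.submatrix_apply, Matrix.mul_apply]
    refine (Fintype.sum_of_injective (Fin.castLE h) (Fin.castLE_injective h) _ _ ?_
      fun _ => rfl).symm
    intro i hi
    rw [hy.2, mul_zero]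
    by_contra hlt
    exact hi ⟨⟨i, by simp only [Fin.lt_def, Fin.val_castLE] at hlt; omega⟩, rfl⟩
  rw [this, Matrix.det_mul, hy.det_submatrix (Fin.strictMono_castLE h), mul_one]

theorem det_lowerLeft_unitriangular_mul {n j : ℕ} (h : j ≤ n) (A : Matrix (Fin n) (Fin n) ℂ)
    {x : Matrix (Fin n) (Fin n) ℂ} (hx : IsUnitriangular x) :
    ((x * A).submatrix (lastIndices h) (Fin.castLE h)).det =
      (A.submatrix (lastIndices h) (Fin.castLE h)).det := by
  have : (x * A).submatrix (lastIndices h) (Fin.castLE h) =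
      x.submatrix (lastIndices h) (lastIndices h) *
        A.submatrix (lastIndices h) (Fin.castLE h) := by
    ext a b
    simp only [Matrix.submatrix_apply, Matrix.mul_apply]
    refine (Fintype.sum_of_injective (lastIndices h) (lastIndices_strictMono h).injective _ _ ?_
      fun _ => rfl).symm
    intro i hi
    rw [hx.2, zero_mul]
    by_contra hlt
    exact hi (mem_range_lastIndices h (by simp only [Fin.lt_def, lastIndices] at hlt; omega))
  rw [this, Matrix.det_mul, hx.det_submatrix (lastIndices_strictMono h), one_mul]

theorem IsCounterDiag.det_lowerLeft_succ {n j : ℕ} (h : j + 1 ≤ n)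
    {q : Matrix (Fin n) (Fin n) ℂ} (hq : IsCounterDiag q) :
    (q.submatrix (lastIndices h) (Fin.castLE h)).det =
      (-1) ^ j * q ⟨n - (j + 1), by omega⟩ ⟨j, by omega⟩ *
        (q.submatrix (lastIndices (j.le_succ.trans h)) (Fin.castLE (j.le_succ.trans h))).det := by
  rw [Matrix.det_succ_row_zero, Finset.sum_eq_single (Fin.last j)]
  · rw [Matrix.submatrix_submatrix, Fin.succAbove_last]
    congr 2
    congr 1
    ext i
    simp only [lastIndices, Function.comp_apply, Fin.val_succ]
    omega
  · intro b _ hb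
    rw [Matrix.submatrix_apply, hq, mul_zero, zero_mul]
    have hb' : (b : ℕ) ≠ j := fun hbj => hb (Fin.ext hbj)
    simp only [lastIndices, Fin.val_zero, Fin.val_castLE]
    omega
  · simp

/-- if `A ∈ GL(n, ℂ)` is generic and `x, y` are the (unique) upper unitriangular
matrices such that `q = x⁻¹ A y` is counter-diagonal, then (in 1-based notation)
`q_{n,1} = A_{n,1}` and for `1 < j ≤ n`,
`q_{n-j+1, j} = (−1)^{j−1} |A|_{{n−j+1,…,n},{1,…,j}} / |A|_{{n−j+2,…,n},{1,…,j−1}}`.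
(Indices are translated to 0-based form: 1-based index `i` corresponds to `i - 1 : Fin n`.) -/
theorem counterDiag_entries {n : ℕ} (hn : 1 ≤ n) (A x y : Matrix (Fin n) (Fin n) ℂ)
    (hA : IsGeneric A) (hdet : A.det ≠ 0)
    (hx : IsUnitriangular x) (hy : IsUnitriangular y)
    (hq : IsCounterDiag (x⁻¹ * A * y)) :
    (x⁻¹ * A * y) ⟨n - 1, by omega⟩ ⟨0, by omega⟩ = A ⟨n - 1, by omega⟩ ⟨0, by omega⟩ ∧
    ∀ (j : ℕ) (hj1 : 1 < j) (hj2 : j ≤ n),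
      (x⁻¹ * A * y) ⟨n - j, by omega⟩ ⟨j - 1, by omega⟩ =
        (-1 : ℂ) ^ (j - 1) *
          minor A (Finset.univ.filter fun r : Fin n => n - j ≤ (r : ℕ))
            (Finset.univ.filter fun c : Fin n => (c : ℕ) < j) /
          minor A (Finset.univ.filter fun r : Fin n => n - j + 1 ≤ (r : ℕ))
            (Finset.univ.filter fun c : Fin n => (c : ℕ) < j - 1) := by
  have hlow : ∀ {j : ℕ} (h : j ≤ n),
      ((x⁻¹ * A * y).submatrix (lastIndices h) (Fin.castLE h)).det =
        (A.submatrix (lastIndices h) (Fin.castLE h)).det := by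
    intro j h
    have hxq : x * (x⁻¹ * A * y) = A * y := by
      rw [mul_assoc, Matrix.mul_nonsing_inv_cancel_left _ _ (by simp [hx.det])]
    rw [← det_lowerLeft_unitriangular_mul h _ hx, hxq, det_lowerLeft_mul_unitriangular h _ hy]
  refine ⟨?_, ?_⟩
  · simpa [lastIndices, Fin.castLE] using hlow hn
  · intro j hj1 hj2
    obtain ⟨j, rfl⟩ : ∃ m, j = m + 1 := ⟨j - 1, by omega⟩
    have hj : j ≤ n := by omega
    have hne := hA (n - j) (by omega)
    rw [Nat.sub_sub_self hj, minor_lowerLeft hj A rfl] at hne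
    simp only [Nat.add_sub_cancel]
    rw [minor_lowerLeft hj2 A rfl, minor_lowerLeft hj A (by omega), eq_div_iff hne,
      ← hlow hj2, hq.det_lowerLeft_succ hj2, hlow hj]
    have hsign : ((-1 : ℂ) ^ j) * (-1) ^ j = 1 := by rw [← mul_pow]; simp
    linear_combination (-(x⁻¹ * A * y) ⟨n - (j + 1), by omega⟩ ⟨j, by omega⟩ *
      (A.submatrix (lastIndices hj) (Fin.castLE hj)).det) * hsign
end

section
/- Let n ≥ 2 and let a_{i,j} and b_{i,j} be nonzero complex numbers, for 1 ≤ i ≤ n−1 and 1 ≤ j ≤ n−i. Then the equality of products of elementary matrices π_{n−1}(a_{1,1},…,a_{1,n−1}) · π_{n−2}(a_{2,1},…,a_{2,n−2}) ⋯ π_1(a_{n−1,1}) = π_{n−1}(b_{1,1},…,b_{1,n−1}) · π_{n−2}(b_{2,1},…,b_{2,n−2}) ⋯ π_1(b_{n−1,1}) holds if and only if a_{i,j} = b_{i,j} for all i, j. -/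
/-- `x_k(c)` (1-based `k`): the `n × n` identity matrix with the entry in (1-based) position
`(k, k+1)` replaced by `c`. -/
def xElem (n k : ℕ) (v : ℂ) : Matrix (Fin n) (Fin n) ℂ :=
  Matrix.of fun i j : Fin n => if i = j then 1 else
    if (i : ℕ) + 1 = k ∧ (j : ℕ) = k then v else 0

/-- `π_k(b₁, …, b_k) = x₁(b₁) · x₂(b₂) ⋯ x_k(b_k)`, where `b` is 1-indexed. -/
noncomputable def piMat (n k : ℕ) (b : ℕ → ℂ) : Matrix (Fin n) (Fin n) ℂ :=
  ((List.range k).map fun m => xElem n (m + 1) (b (m + 1))).prod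

/-- The ordered product `π_{n−1}(a_{1,1},…,a_{1,n−1}) · π_{n−2}(a_{2,1},…,a_{2,n−2}) ⋯
π₁(a_{n−1,1})`, where `a` is 1-indexed in both arguments. -/
noncomputable def triProd (n : ℕ) (a : ℕ → ℕ → ℂ) : Matrix (Fin n) (Fin n) ℂ :=
  ((List.range (n - 1)).map fun i => piMat n (n - 1 - i) (a (i + 1))).prod

theorem isUnit_xElem (n k : ℕ) (v : ℂ) : IsUnit (xElem n k v) := by
  rw [Matrix.isUnit_iff_isUnit_det, Matrix.det_of_isUpperTriangular]
  · simp [xElem]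
  · intro i j hij
    have hij : (j : ℕ) < i := hij
    simp only [xElem, Matrix.of_apply]
    rw [if_neg (by rintro rfl; omega), if_neg (by omega)]

theorem isUnit_piMat (n k : ℕ) (b : ℕ → ℂ) : IsUnit (piMat n k b) := by
  refine List.prod_isUnit fun M hM => ?_
  obtain ⟨m, -, rfl⟩ := List.mem_map.1 hM
  exact isUnit_xElem n _ _

theorem piMat_zero (n : ℕ) (b : ℕ → ℂ) : piMat n 0 b = 1 := by
  simp [piMat]

theorem piMat_succ (n k : ℕ) (b : ℕ → ℂ) :
    piMat n (k + 1) b = piMat n k b * xElem n (k + 1) (b (k + 1)) := by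
  simp [piMat, List.range_succ]

theorem piMat_congr {n k : ℕ} {b c : ℕ → ℂ} (h : ∀ j, 1 ≤ j → j ≤ k → b j = c j) :
    piMat n k b = piMat n k c := by
  unfold piMat
  congr 1
  refine List.map_congr_left fun m hm => ?_
  rw [h (m + 1) (by omega) (by have := List.mem_range.1 hm; omega)]

theorem xElem_mulVec_single_of_ne {n k : ℕ} (v : ℂ) (j : Fin n) (hj : (j : ℕ) ≠ k) :
    (xElem n k v).mulVec (Pi.single j 1) = Pi.single j 1 := by
  ext i
  simp [xElem, Pi.single_apply, hj]

theorem xElem_mulVec_single {n k : ℕ} (v : ℂ) (hk : k + 1 < n) :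
    (xElem n (k + 1) v).mulVec (Pi.single ⟨k + 1, hk⟩ 1) =
      Pi.single ⟨k + 1, hk⟩ 1 + v • Pi.single ⟨k, by omega⟩ 1 := by
  ext i
  simp only [xElem, Matrix.mulVec_single_one, Matrix.col_apply, Matrix.of_apply, Pi.add_apply,
    Pi.smul_apply, Pi.single_apply, Fin.ext_iff, smul_eq_mul]
  split_ifs <;> first | omega | simp_all

theorem piMat_mulVec_single_of_lt {n k : ℕ} (b : ℕ → ℂ) (j : Fin n) (hj : k < j) :
    (piMat n k b).mulVec (Pi.single j 1) = Pi.single j 1 := by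
  induction k with
  | zero => rw [piMat_zero, Matrix.one_mulVec]
  | succ k ih =>
    rw [piMat_succ, ← Matrix.mulVec_mulVec, xElem_mulVec_single_of_ne _ _ (by omega),
      ih (by omega)]

theorem piMat_mulVec_single_succ {n k : ℕ} (b : ℕ → ℂ) (hk : k + 1 < n) :
    (piMat n (k + 1) b).mulVec (Pi.single ⟨k + 1, hk⟩ 1) = Pi.single ⟨k + 1, hk⟩ 1 +
      b (k + 1) • (piMat n k b).mulVec (Pi.single ⟨k, by omega⟩ 1) := by
  rw [piMat_succ, ← Matrix.mulVec_mulVec, xElem_mulVec_single, Matrix.mulVec_add,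
    Matrix.mulVec_smul, piMat_mulVec_single_of_lt _ _ (by simp)]

theorem piMat_mulVec_single_apply_of_lt {n k : ℕ} (b : ℕ → ℂ) (hk : k < n) (i : Fin n)
    (hi : k < i) : (piMat n k b).mulVec (Pi.single ⟨k, hk⟩ 1) i = 0 := by
  induction k with
  | zero => simp [piMat_zero, Matrix.one_apply, Fin.ext_iff]; omega
  | succ k ih =>
    rw [piMat_mulVec_single_succ, Pi.add_apply, Pi.smul_apply, ih _ (by omega),
      Pi.single_eq_of_ne (by rintro rfl; simp at hi)]
    simp

theorem piMat_mulVec_single_apply_self {n k : ℕ} (b : ℕ → ℂ) (hk : k < n) :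
    (piMat n k b).mulVec (Pi.single ⟨k, hk⟩ 1) ⟨k, hk⟩ = 1 := by
  cases k with
  | zero => simp [piMat_zero]
  | succ k =>
    rw [piMat_mulVec_single_succ, Pi.add_apply, Pi.smul_apply,
      piMat_mulVec_single_apply_of_lt _ _ _ (by simp)]
    simp

/-- The nonzero parameters of `piMat n k b` can be read off its `k`-th column. -/
theorem eq_of_piMat_mulVec_single_eq {n k : ℕ} {b c : ℕ → ℂ} (hk : k < n)
    (hb : ∀ j, 1 ≤ j → j ≤ k → b j ≠ 0)
    (h : (piMat n k b).mulVec (Pi.single ⟨k, hk⟩ 1) =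
      (piMat n k c).mulVec (Pi.single ⟨k, hk⟩ 1)) :
    ∀ j, 1 ≤ j → j ≤ k → b j = c j := by
  induction k with
  | zero => intro j _ _; omega
  | succ k ih =>
    rw [piMat_mulVec_single_succ, piMat_mulVec_single_succ, add_right_inj] at h
    have hbc : b (k + 1) = c (k + 1) := by
      simpa only [Pi.smul_apply, piMat_mulVec_single_apply_self, smul_eq_mul, mul_one] using
        congrFun h ⟨k, by omega⟩
    rw [← hbc] at h
    have h' := smul_right_injective _ (hb (k + 1) (by omega) le_rfl) h
    intro j hj hjk
    rcases Nat.lt_or_ge k j with hlt | hle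
    · obtain rfl : j = k + 1 := by omega
      exact hbc
    · exact ih (by omega) (fun j h1 h2 => hb j h1 (by omega)) h' j hj hle

/-- The product `π_k(a_{1,∗}) ⋯ π₁(a_{k,1})` inside `n × n` matrices. -/
noncomputable def triProdAux (n k : ℕ) (a : ℕ → ℕ → ℂ) : Matrix (Fin n) (Fin n) ℂ :=
  ((List.range k).map fun i => piMat n (k - i) (a (i + 1))).prod

theorem triProdAux_succ (n k : ℕ) (a : ℕ → ℕ → ℂ) :
    triProdAux n (k + 1) a = piMat n (k + 1) (a 1) * triProdAux n k fun i => a (i + 1) := by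
  simp [triProdAux, List.range_succ_eq_map, Function.comp_def]

theorem triProdAux_mulVec_single_of_lt {n k : ℕ} (a : ℕ → ℕ → ℂ) (j : Fin n) (hj : k < j) :
    (triProdAux n k a).mulVec (Pi.single j 1) = Pi.single j 1 := by
  induction k generalizing a with
  | zero => exact Matrix.one_mulVec _
  | succ k ih =>
    rw [triProdAux_succ, ← Matrix.mulVec_mulVec, ih _ (by omega), piMat_mulVec_single_of_lt _ _ hj]

theorem triProdAux_injective {n k : ℕ} (hk : k < n) {a b : ℕ → ℕ → ℂ}
    (ha : ∀ i j, 1 ≤ i → i ≤ k → 1 ≤ j → j ≤ k + 1 - i → a i j ≠ 0)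
    (h : triProdAux n k a = triProdAux n k b) :
    ∀ i j, 1 ≤ i → i ≤ k → 1 ≤ j → j ≤ k + 1 - i → a i j = b i j := by
  induction k generalizing a b with
  | zero => intro i j _ _; omega
  | succ k ih =>
    rw [triProdAux_succ, triProdAux_succ] at h
    have hcol := congrArg (fun M => M.mulVec (Pi.single ⟨k + 1, hk⟩ 1)) h
    simp only [← Matrix.mulVec_mulVec] at hcol
    rw [triProdAux_mulVec_single_of_lt _ _ (by simp),
      triProdAux_mulVec_single_of_lt _ _ (by simp)] at hcol
    have hrow := eq_of_piMat_mulVec_single_eq hk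
      (fun j h1 h2 => ha 1 j le_rfl (by omega) h1 (by omega)) hcol
    rw [← piMat_congr hrow] at h
    have htail := ih (by omega)
      (fun i j h1 h2 h3 h4 => ha (i + 1) j (by omega) (by omega) h3 (by omega))
      ((isUnit_piMat n _ _).mul_left_cancel h)
    intro i j h1 h2 h3 h4
    obtain ⟨i, rfl⟩ := Nat.exists_eq_add_of_le' h1
    rcases Nat.eq_zero_or_pos i with rfl | hi
    · exact hrow j h3 (by omega)
    · exact htail i j hi (by omega) h3 (by omega)

/-- for nonzero complex numbers `a_{i,j}`, `b_{i,j}` (`1 ≤ i ≤ n−1`,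
`1 ≤ j ≤ n−i`), the products of elementary matrices
`π_{n−1}(a_{1,∗}) ⋯ π₁(a_{n−1,1})` and `π_{n−1}(b_{1,∗}) ⋯ π₁(b_{n−1,1})` are equal if and
only if `a_{i,j} = b_{i,j}` for all `i, j`. -/
theorem unique_factorization (n : ℕ) (hn : 2 ≤ n) (a b : ℕ → ℕ → ℂ)
    (ha : ∀ i j : ℕ, 1 ≤ i → i ≤ n - 1 → 1 ≤ j → j ≤ n - i → a i j ≠ 0)
    (hb : ∀ i j : ℕ, 1 ≤ i → i ≤ n - 1 → 1 ≤ j → j ≤ n - i → b i j ≠ 0) :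
    triProd n a = triProd n b ↔
      ∀ i j : ℕ, 1 ≤ i → i ≤ n - 1 → 1 ≤ j → j ≤ n - i → a i j = b i j := by
  constructor
  · intro h i j h1 h2 h3 h4
    exact triProdAux_injective (n := n) (k := n - 1) (by omega)
      (fun i j h1 h2 h3 h4 => ha i j h1 h2 h3 (by omega)) h i j h1 h2 h3 (by omega)
  · intro h
    unfold triProd
    congr 1
    refine List.map_congr_left fun i hi => piMat_congr fun j h1 h2 => ?_
    have := List.mem_range.1 hi
    exact h (i + 1) j (by omega) (by omega) h1 (by omega)
end

section
/- Let n ≥ 2 and let c be any assignment of a nonzero complex number c_t to each non-vertex point t of T^2(n). Then there exist matrices g_0, g_1, g_2 ∈ SL(n,ℂ) whose Ptolemy coordinates at every non-vertex point t ∈ T^2(n) equal c_t. -/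
/-- A linear recurrence whose leading coefficients do not vanish has a solution. -/
theorem exists_solution_linear_recurrence {K : Type*} [Field K] (k : ℕ)
    (coef : ℕ → Fin (k + 1) → K) (hcoef : ∀ a, coef a (Fin.last k) ≠ 0) (v : ℕ → K) :
    ∃ y : ℕ → K, ∀ a, ∑ r : Fin (k + 1), coef a r * y (a + r) = v a := by
  suffices h : ∃ y : ℕ → K, ∀ i, y i = if k ≤ i then
      (v (i - k) - ∑ r : Fin k, coef (i - k) r.castSucc * y (i - k + r)) /
        coef (i - k) (Fin.last k) else 0 by
    obtain ⟨y, hy⟩ := h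
    refine ⟨y, fun a => ?_⟩
    rw [Fin.sum_univ_castSucc]
    have h1 := hy (a + k)
    rw [if_pos (Nat.le_add_left k a), Nat.add_sub_cancel, eq_div_iff (hcoef a)] at h1
    simp only [Fin.val_castSucc, Fin.val_last]
    linear_combination h1
  let F : (i : ℕ) → ((j : ℕ) → j < i → K) → K := fun i y => if h : k ≤ i then
      (v (i - k) - ∑ r : Fin k, coef (i - k) r.castSucc *
        y (i - k + r) (by have := r.isLt; omega)) / coef (i - k) (Fin.last k) else 0
  refine ⟨WellFounded.fix Nat.lt_wfRel.wf F, fun i => ?_⟩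
  rw [WellFounded.fix_eq]
  by_cases h : k ≤ i <;> simp only [F, h, if_true, if_false, dif_pos, dif_neg, not_false_eq_true]

/-- The minors on consecutive rows and initial columns of an infinite matrix can be prescribed
arbitrarily, as long as they do not vanish. -/
theorem exists_consecutive_minors_eq {K : Type*} [Field K] (m : ℕ → ℕ → K)
    (hm : ∀ a k, m a k ≠ 0) (hm0 : ∀ a, m a 0 = 1) (n : ℕ) :
    ∃ x : ℕ → ℕ → K, ∀ k ≤ n, ∀ a,
      (Matrix.of fun r s : Fin k => x (a + r) s).det = m a k := by
  induction n with
  | zero =>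
    refine ⟨0, fun k hk a => ?_⟩
    obtain rfl : k = 0 := by omega
    simp [hm0]
  | succ n ih =>
    obtain ⟨x, hx⟩ := ih
    obtain ⟨y, hy⟩ := exists_solution_linear_recurrence n
      (fun a r => (-1) ^ ((r : ℕ) + n) *
        (Matrix.of fun i j : Fin n => x (a + r.succAbove i) j).det)
      (fun a => by simp [hx n le_rfl a, hm]) (fun a => m a (n + 1))
    refine ⟨fun i j => if j = n then y i else x i j, fun k hk a => ?_⟩
    rcases Nat.lt_or_ge n k with h | h
    · obtain rfl : k = n + 1 := by omega
      rw [Matrix.det_succ_column _ (Fin.last n), ← hy a]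
      refine Finset.sum_congr rfl fun r _ => ?_
      have : (Matrix.of fun r s : Fin (n + 1) =>
          if (s : ℕ) = n then y (a + r) else x (a + r) s).submatrix r.succAbove
            (Fin.last n).succAbove = Matrix.of fun i j : Fin n => x (a + r.succAbove i) j := by
        ext i j
        simp [j.isLt.ne]
      rw [this]
      simp
      ring
    · rw [← hx k h a]
      congr 1
      ext r s
      have : (s : ℕ) ≠ n := by omega
      simp [this]

/-- The determinant of the matrix whose columns are the first `p` columns of the identity, the
first `q` columns of the antidiagonal matrix with entries `d` and the first `s` columns of `x` is,
up to a nonzero factor, a product of entries of `d` times a minor of `x`. -/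
theorem exists_det_eq_prod_mul_minor (p q s n : ℕ) (h : p + q + s = n) :
    ∃ ε : ℂ, ε ≠ 0 ∧ ∀ (d : ℕ → ℂ) (x : ℕ → ℕ → ℂ),
      (Matrix.of fun r c : Fin n =>
        if (c : ℕ) < p then (if (r : ℕ) = c then 1 else 0)
        else if (c : ℕ) < p + q then (if (r : ℕ) + (c - p) + 1 = n then d (c - p) else 0)
        else x r (c - p - q)).det =
      ε * (∏ b ∈ Finset.range q, d b) * (Matrix.of fun i j : Fin s => x (p + i) j).det := by
  let fR : Fin p ⊕ Fin q ⊕ Fin s → Fin n := Sum.elim (fun a => ⟨a, by omega⟩)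
    (Sum.elim (fun b => ⟨n - 1 - b, by omega⟩) (fun c => ⟨p + c, by omega⟩))
  let fC : Fin p ⊕ Fin q ⊕ Fin s → Fin n := Sum.elim (fun a => ⟨a, by omega⟩)
    (Sum.elim (fun b => ⟨p + b, by omega⟩) (fun c => ⟨p + q + c, by omega⟩))
  have hcard : Fintype.card (Fin p ⊕ Fin q ⊕ Fin s) = Fintype.card (Fin n) := by
    simp; omega
  have hR : Function.Bijective fR := by
    refine (Fintype.bijective_iff_injective_and_card _).2 ⟨?_, hcard⟩
    rintro (a | a | a) (b | b | b) hab <;>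
      simp only [fR, Sum.elim_inl, Sum.elim_inr, reduceCtorEq, Sum.inl.injEq,
        Sum.inr.injEq, Fin.ext_iff] at hab ⊢ <;> omega
  have hC : Function.Bijective fC := by
    refine (Fintype.bijective_iff_injective_and_card _).2 ⟨?_, hcard⟩
    rintro (a | a | a) (b | b | b) hab <;>
      simp only [fC, Sum.elim_inl, Sum.elim_inr, reduceCtorEq, Sum.inl.injEq,
        Sum.inr.injEq, Fin.ext_iff] at hab ⊢ <;> omega
  let eR := Equiv.ofBijective fR hR
  let eC := Equiv.ofBijective fC hC
  refine ⟨((Equiv.Perm.sign (eC.symm.trans eR) : ℤ) : ℂ), by simp, fun d x => ?_⟩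
  set A : Matrix (Fin n) (Fin n) ℂ := Matrix.of fun r c : Fin n =>
        if (c : ℕ) < p then (if (r : ℕ) = c then 1 else 0)
        else if (c : ℕ) < p + q then (if (r : ℕ) + (c - p) + 1 = n then d (c - p) else 0)
        else x r (c - p - q) with hA
  have hdet : (A.submatrix eR eC).det =
      ((Equiv.Perm.sign (eC.symm.trans eR) : ℤ) : ℂ) * A.det := by
    rw [← Matrix.det_permute, ← Matrix.det_submatrix_equiv_self eC]
    congr 1
    ext i j
    simp
  have hblock : A.submatrix eR eC = Matrix.fromBlocks 1
      (Matrix.of fun i j => A (eR (Sum.inl i)) (eC (Sum.inr j))) 0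
      (Matrix.fromBlocks (Matrix.diagonal fun b : Fin q => d b)
        (Matrix.of fun i j => A (eR (Sum.inr (Sum.inl i))) (eC (Sum.inr (Sum.inr j)))) 0
        (Matrix.of fun i j : Fin s => x (p + i) j)) := by
    ext (i | i | i) (j | j | j) <;>
      simp [eR, eC, fR, fC, hA, Matrix.one_apply, Matrix.diagonal_apply, Fin.ext_iff]
    · rfl
    · omega
    · have : (n - 1 - (i : ℕ) + j + 1 = n) ↔ (i : ℕ) = j := by omega
      simp only [this]
      split_ifs with hij <;> simp [hij]
    · omega
    · omega
    · rw [if_neg (by omega)]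
      congr 1
      omega
  have hsq : ((Equiv.Perm.sign (eC.symm.trans eR) : ℤ) : ℂ) *
      ((Equiv.Perm.sign (eC.symm.trans eR) : ℤ) : ℂ) = 1 := by
    rw [← Int.cast_mul, ← Units.val_mul, Int.units_mul_self]; simp
  rw [hblock, Matrix.det_fromBlocks_zero₂₁, Matrix.det_fromBlocks_zero₂₁, Matrix.det_one,
    one_mul, Matrix.det_diagonal, Fin.prod_univ_eq_prod_range (fun b => d b)] at hdet
  rw [mul_assoc, hdet, ← mul_assoc, hsq, one_mul]

theorem ptolemyCoord_three {n : ℕ} (g : Fin 3 → Matrix (Fin n) (Fin n) ℂ)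
    (G : Fin 3 → ℕ → ℕ → ℂ) (hG : ∀ i (r j : Fin n), g i r j = G i r j) (t : Fin 3 → ℕ)
    (ht : t 0 + t 1 + t 2 = n) :
    ptolemyCoord g t = (Matrix.of fun r c : Fin n =>
        if (c : ℕ) < t 0 then G 0 r c
        else if (c : ℕ) < t 0 + t 1 then G 1 r (c - t 0)
        else G 2 r (c - t 0 - t 1)).det := by
  have hcols : ptolemyCols g t =
      (List.range (t 0)).map (fun j (r : Fin n) => if h : j < n then g 0 r ⟨j, h⟩ else 0) ++
      ((List.range (t 1)).map (fun j (r : Fin n) => if h : j < n then g 1 r ⟨j, h⟩ else 0) ++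
      (List.range (t 2)).map (fun j (r : Fin n) => if h : j < n then g 2 r ⟨j, h⟩ else 0)) := by
    simp [ptolemyCols, List.finRange_succ]
  have hlen : (ptolemyCols g t).length = n := by
    simp [hcols]; omega
  rw [ptolemyCoord, dif_pos hlen]
  have hget : ∀ (l : List (Fin n → ℂ)), ptolemyCols g t = l → ∀ i (h : i < (ptolemyCols g t).length)
      (h' : i < l.length), (ptolemyCols g t)[i] = l[i] := by
    rintro l rfl i _ _
    rfl
  congr 1
  ext r c
  rw [Matrix.of_apply, List.get_eq_getElem, hget _ hcols _ _ (by simp; omega)]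
  simp only [Matrix.of_apply, List.getElem_append, Fin.val_cast,
    List.length_map, List.length_range, List.getElem_map, List.getElem_range]
  have hc := c.isLt
  split_ifs <;> first | omega | simp [hG]

theorem ptolemyCoord_vertex {n : ℕ} (g : Fin 3 → Matrix (Fin n) (Fin n) ℂ) (i : Fin 3) :
    ptolemyCoord g (Pi.single i n) = (g i).det := by
  let G : Fin 3 → ℕ → ℕ → ℂ := fun i r j =>
    if h : r < n ∧ j < n then g i ⟨r, h.1⟩ ⟨j, h.2⟩ else 0
  rw [ptolemyCoord_three g G (fun i r j => by simp [G]) _ (by fin_cases i <;> simp)]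
  congr 1
  ext r c
  fin_cases i <;> simp [G]

/-- A nowhere vanishing function on `T²(n)` with value `1` at the vertices is the function of
Ptolemy coordinates of a triple of matrices. -/
theorem exists_matrices_with_ptolemy_coords (n : ℕ) (c : (Fin 3 → ℕ) → ℂ) (hc : ∀ t, c t ≠ 0)
    (hv : ∀ i, c (Pi.single i n) = 1) :
    ∃ g : Fin 3 → Matrix (Fin n) (Fin n) ℂ,
      ∀ t : Fin 3 → ℕ, ∑ i, t i = n → ptolemyCoord g t = c t := by
  have hε' : ∀ p q s : ℕ, ∃ ε : ℂ, ε ≠ 0 ∧ (p + q + s = n → ∀ (d : ℕ → ℂ) (x : ℕ → ℕ → ℂ),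
      (Matrix.of fun r c : Fin n =>
        if (c : ℕ) < p then (if (r : ℕ) = c then 1 else 0)
        else if (c : ℕ) < p + q then (if (r : ℕ) + (c - p) + 1 = n then d (c - p) else 0)
        else x r (c - p - q)).det =
      ε * (∏ b ∈ Finset.range q, d b) * (Matrix.of fun i j : Fin s => x (p + i) j).det) := by
    intro p q s
    by_cases h : p + q + s = n
    · obtain ⟨ε, h0, h1⟩ := exists_det_eq_prod_mul_minor p q s n h
      exact ⟨ε, h0, fun _ => h1⟩
    · exact ⟨1, one_ne_zero, fun h' => absurd h' h⟩
  choose ε hε0 hε using hε'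
  let P : ℕ → ℂ := fun q => if q = 0 then 1 else c ![n - q, q, 0] / ε (n - q) q 0
  have hP : ∀ q, P q ≠ 0 := by
    intro q
    simp only [P]
    split_ifs
    · exact one_ne_zero
    · exact div_ne_zero (hc _) (hε0 _ _ _)
  let d : ℕ → ℂ := fun b => P (b + 1) / P b
  have hd : ∀ q, ∏ b ∈ Finset.range q, d b = P q := by
    intro q
    induction q with
    | zero => simp [P]
    | succ q ih =>
      rw [Finset.prod_range_succ, ih]
      exact mul_div_cancel₀ _ (hP q)
  let m : ℕ → ℕ → ℂ := fun a k => if k = 0 then 1 else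
    c ![a, n - a - k, k] / (ε a (n - a - k) k * P (n - a - k))
  obtain ⟨x, hx⟩ := exists_consecutive_minors_eq m
    (fun a k => by
      simp only [m]
      split_ifs
      · exact one_ne_zero
      · exact div_ne_zero (hc _) (mul_ne_zero (hε0 _ _ _) (hP _)))
    (fun a => by simp [m]) n
  let G : Fin 3 → ℕ → ℕ → ℂ := ![fun r j => if r = j then 1 else 0,
    fun r j => if r + j + 1 = n then d j else 0, x]
  let g : Fin 3 → Matrix (Fin n) (Fin n) ℂ := fun i => Matrix.of fun r j => G i r j
  refine ⟨g, fun t ht => ?_⟩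
  rw [Fin.sum_univ_three] at ht
  have hfin := hε (t 0) (t 1) (t 2) ht d x
  rw [hd, hx (t 2) (by omega)] at hfin
  have hteq : t = ![t 0, t 1, t 2] := by
    ext i; fin_cases i <;> rfl
  by_cases h2 : t 2 = 0
  · by_cases h1 : t 1 = 0
    · have : t = Pi.single 0 n := by
        ext i
        fin_cases i <;> simp <;> omega
      rw [this, ptolemyCoord_vertex, hv]
      have : g 0 = 1 := by
        ext r j
        simp [g, G, Matrix.one_apply, Fin.ext_iff]
      simp [this]
    · refine (ptolemyCoord_three g G (fun _ _ _ => rfl) t ht).trans (hfin.trans ?_)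
      have h0 : n - t 1 = t 0 := by omega
      have hε1 := hε0 (t 0) (t 1) 0
      simp only [m, P, h1, h2, if_true, if_false, h0, mul_one]
      rw [mul_div_cancel₀ _ hε1]
      exact congrArg c (hteq.trans (by rw [h2])).symm
  · refine (ptolemyCoord_three g G (fun _ _ _ => rfl) t ht).trans (hfin.trans ?_)
    have h1 : n - t 0 - t 2 = t 1 := by omega
    simp only [m, h2, if_false, h1]
    rw [mul_div_cancel₀ _ (mul_ne_zero (hε0 _ _ _) (hP _)), ← hteq]

/-- for any assignment of nonzero complex numbers `c t` to the non-vertex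
points `t` of `T²(n)` (tuples `t : Fin 3 → ℕ` with `∑ t = n` and all `t i < n`), there exist
matrices `g₀, g₁, g₂ ∈ SL(n, ℂ)` whose Ptolemy coordinates at every non-vertex point equal
`c t`. -/
theorem exists_triple_with_ptolemy_coords (n : ℕ) (hn : 2 ≤ n) (c : (Fin 3 → ℕ) → ℂ)
    (hc : ∀ t : Fin 3 → ℕ, ∑ i, t i = n → (∀ i, t i < n) → c t ≠ 0) :
    ∃ g : Fin 3 → Matrix.SpecialLinearGroup (Fin n) ℂ,
      ∀ t : Fin 3 → ℕ, ∑ i, t i = n → (∀ i, t i < n) →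
        ptolemyCoord (fun i => (g i : Matrix (Fin n) (Fin n) ℂ)) t = c t := by
  classical
  obtain ⟨g, hg⟩ := exists_matrices_with_ptolemy_coords n
    (fun t => if ∑ i, t i = n ∧ ∀ i, t i < n then c t else 1)
    (fun t => by
      split_ifs with h
      · exact hc t h.1 h.2
      · exact one_ne_zero)
    (fun i => if_neg fun h => by simpa using h.2 i)
  refine ⟨fun i => ⟨g i, ?_⟩, fun t ht ht' => (hg t ht).trans (if_pos ⟨ht, ht'⟩)⟩
  rw [← ptolemyCoord_vertex, hg _ (by simp)]
  exact if_neg fun h => by simpa using h.2 i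
end

section
/- Let n ≥ 2, k ≥ 1, and let (g_0,…,g_k) and (h_0,…,h_k) be tuples of matrices in SL(n,ℂ) such that all Ptolemy coordinates of both tuples are nonzero and the Ptolemy coordinates of the two tuples agree at every t ∈ T^k(n). Then there exists g ∈ SL(n,ℂ) and upper unitriangular matrices u_0,…,u_k such that h_i = g · g_i · u_i for all i; that is, a generic tuple is determined up to the diagonal SL(n,ℂ)-action by its Ptolemy coordinates. -/
open Matrix Finset

section PtolemyDeterminant

variable {n m : ℕ}

/-- The columns selected by `t`, as a matrix whose columns are indexed by a sigma type. -/
def colsMat (g : Fin m → Matrix (Fin n) (Fin n) ℂ) (t : Fin m → ℕ) (ht : ∀ i, t i ≤ n) :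
    Matrix (Fin n) (Σ i, Fin (t i)) ℂ :=
  Matrix.of fun r p => g p.1 r (Fin.castLE (ht p.1) p.2)

lemma le_of_sum_eq {t : Fin m → ℕ} (hs : ∑ i, t i = n) (i : Fin m) : t i ≤ n :=
  hs ▸ Finset.single_le_sum (fun _ _ => Nat.zero_le _) (Finset.mem_univ i)

/-- A Ptolemy coordinate is the determinant of `colsMat`, for an enumeration of the columns
which does not depend on the tuple. -/
lemma exists_equiv_ptolemyCoord_eq_det {t : Fin m → ℕ} (hs : ∑ i, t i = n) :
    ∃ σ : Fin n ≃ Σ i, Fin (t i), ∀ g : Fin m → Matrix (Fin n) (Fin n) ℂ,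
      ptolemyCoord g t = ((colsMat g t (le_of_sum_eq hs)).submatrix id σ).det := by
  classical
  let L : List (Σ i, Fin (t i)) := (List.finRange m).sigma fun i => List.finRange (t i)
  have hL : L.Nodup := (List.nodup_finRange m).sigma fun i => List.nodup_finRange (t i)
  have hmem : ∀ p, p ∈ L := fun p => by
    obtain ⟨i, j⟩ := p
    exact List.mem_sigma.2 ⟨List.mem_finRange _, List.mem_finRange _⟩
  have hlen : L.length = n := by
    simp [L, List.length_sigma, ← hs, ← Fin.sum_univ_def]
  have hcols : ∀ g : Fin m → Matrix (Fin n) (Fin n) ℂ, ptolemyCols g t =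
      L.map fun p r => g p.1 r (Fin.castLE (le_of_sum_eq hs p.1) p.2) := by
    intro g
    simp only [ptolemyCols, L, List.sigma, List.map_flatMap, List.map_map]
    congr 1
    funext i
    rw [← List.map_coe_finRange_eq_range, List.map_map]
    refine List.map_congr_left fun j _ => ?_
    funext r
    have : (j : ℕ) < n := j.2.trans_le (le_of_sum_eq hs i)
    simp [this, Fin.castLE]
  refine ⟨(finCongr hlen.symm).trans (hL.getEquivOfForallMemList L hmem), fun g => ?_⟩
  have hlen' : (ptolemyCols g t).length = n := by rw [hcols, List.length_map, hlen]
  rw [ptolemyCoord, dif_pos hlen']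
  congr 1
  ext r c
  simp [colsMat, List.getElem_of_eq (hcols g)]

lemma colsMat_mulVec {t : Fin m → ℕ} (ht : ∀ i, t i ≤ n)
    (g : Fin m → Matrix (Fin n) (Fin n) ℂ) {z : Fin m → Fin n → ℂ}
    (hz : ∀ j (k : Fin n), t j ≤ (k : ℕ) → z j k = 0) :
    (colsMat g t ht *ᵥ fun p => z p.1 (Fin.castLE (ht p.1) p.2)) = ∑ j, g j *ᵥ z j := by
  ext r
  simp only [colsMat, mulVec, dotProduct, Fintype.sum_sigma, Finset.sum_apply, of_apply]
  refine Finset.sum_congr rfl fun j _ => ?_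
  refine Fintype.sum_of_injective (Fin.castLE (ht j)) (Fin.castLE_injective _) _ _ ?_ ?_
  · intro k hk
    rw [hz j k, mul_zero]
    by_contra! hlt
    exact hk ⟨⟨k, hlt⟩, rfl⟩
  · intro k
    rfl

/-- If a Ptolemy coordinate is nonzero, the selected columns span. -/
lemma exists_sum_mulVec_eq {t : Fin m → ℕ} (hs : ∑ i, t i = n)
    {g : Fin m → Matrix (Fin n) (Fin n) ℂ} (hg : ptolemyCoord g t ≠ 0) (w : Fin n → ℂ) :
    ∃ z : Fin m → Fin n → ℂ, (∀ j (k : Fin n), t j ≤ (k : ℕ) → z j k = 0) ∧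
      ∑ j, g j *ᵥ z j = w := by
  obtain ⟨σ, hσ⟩ := exists_equiv_ptolemyCoord_eq_det hs
  have hle := le_of_sum_eq hs
  rw [hσ] at hg
  obtain ⟨y, hy⟩ := (mulVec_surjective_iff_isUnit.2
    ((isUnit_iff_isUnit_det _).2 (isUnit_iff_ne_zero.2 hg))) w
  refine ⟨fun j k => if hk : (k : ℕ) < t j then y (σ.symm ⟨j, ⟨k, hk⟩⟩) else 0, ?_, ?_⟩
  · intro j k hk
    simp [not_lt.2 hk]
  · rw [← colsMat_mulVec hle g (fun j k hk => by simp [not_lt.2 hk]), ← hy]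
    ext r
    simp only [mulVec, dotProduct, submatrix_apply, id]
    rw [← σ.sum_comp]
    simp

/-- If a Ptolemy coordinate is nonzero, the selected columns are linearly independent. -/
lemma eq_zero_of_sum_mulVec_eq_zero {t : Fin m → ℕ} (hs : ∑ i, t i = n)
    {g : Fin m → Matrix (Fin n) (Fin n) ℂ} (hg : ptolemyCoord g t ≠ 0)
    {z : Fin m → Fin n → ℂ} (hz : ∀ j (k : Fin n), t j ≤ (k : ℕ) → z j k = 0)
    (h0 : ∑ j, g j *ᵥ z j = 0) : z = 0 := by
  obtain ⟨σ, hσ⟩ := exists_equiv_ptolemyCoord_eq_det hs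
  have hle := le_of_sum_eq hs
  rw [hσ] at hg
  rw [← colsMat_mulVec hle g hz] at h0
  have h1 : ((colsMat g t hle).submatrix id σ) *ᵥ
      (fun c => z (σ c).1 (Fin.castLE (hle _) (σ c).2)) = 0 := by
    rw [← h0]
    ext r
    simp only [mulVec, dotProduct, submatrix_apply, id]
    exact σ.sum_comp fun p => colsMat g t hle r p * z p.1 (Fin.castLE (hle _) p.2)
  have h2 := eq_zero_of_mulVec_eq_zero hg h1
  ext j k
  by_cases hk : t j ≤ (k : ℕ)
  · exact hz j k hk
  · have := congrFun h2 (σ.symm ⟨j, ⟨k, not_le.1 hk⟩⟩)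
    rw [σ.apply_symm_apply] at this
    exact this

lemma ptolemyCoord_congr {t : Fin m → ℕ} (hs : ∑ i, t i = n)
    {x y : Fin m → Matrix (Fin n) (Fin n) ℂ}
    (hxy : ∀ j (k : Fin n), (k : ℕ) < t j → ∀ r, x j r k = y j r k) :
    ptolemyCoord x t = ptolemyCoord y t := by
  obtain ⟨σ, hσ⟩ := exists_equiv_ptolemyCoord_eq_det hs
  rw [hσ, hσ]
  congr 1
  ext r c
  exact hxy _ _ (by simp) r

/-- **Cramer's rule** for Ptolemy coordinates. -/
lemma ptolemyCoord_eq_mul_of_col_eq {t : Fin m → ℕ} (hs : ∑ i, t i = n)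
    {x y : Fin m → Matrix (Fin n) (Fin n) ℂ} {i : Fin m} {c : Fin n} (hc : (c : ℕ) < t i)
    (hxy : ∀ j (k : Fin n), (k : ℕ) < t j → ¬ (j = i ∧ k = c) → ∀ r, y j r k = x j r k)
    {z : Fin m → Fin n → ℂ} (hz : ∀ j (k : Fin n), t j ≤ (k : ℕ) → z j k = 0)
    (hcol : (y i).col c = ∑ j, x j *ᵥ z j) :
    ptolemyCoord y t = z i c * ptolemyCoord x t := by
  obtain ⟨σ, hσ⟩ := exists_equiv_ptolemyCoord_eq_det hs
  have hle := le_of_sum_eq hs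
  rw [hσ, hσ]
  set M := (colsMat x t hle).submatrix id σ with hM
  set w : Fin n → ℂ := fun c => z (σ c).1 (Fin.castLE (hle _) (σ c).2) with hw
  have hMw : M *ᵥ w = (y i).col c := by
    rw [hcol, ← colsMat_mulVec hle x hz]
    ext r
    simp only [mulVec, dotProduct, hM, hw, submatrix_apply, id]
    exact σ.sum_comp fun p => colsMat x t hle r p * z p.1 (Fin.castLE (hle _) p.2)
  set p : Fin n := σ.symm ⟨i, ⟨c, hc⟩⟩ with hp
  have hupd : (colsMat y t hle).submatrix id σ = M.updateCol p (M *ᵥ w) := by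
    ext r q
    rw [updateCol_apply]
    split_ifs with hq
    · rw [hMw, hq]
      simp [colsMat, hp]
    · simp only [hM, submatrix_apply, colsMat, of_apply, id]
      refine hxy _ _ (by simp) ?_ r
      rintro ⟨h1, h2⟩
      apply hq
      rw [hp, Equiv.eq_symm_apply]
      generalize σ q = s at h1 h2
      obtain ⟨j, k⟩ := s
      subst h1
      congr 1
      ext
      simpa using congrArg Fin.val h2
  have hwp : w p = z i c := by
    have haux : ∀ s : Σ i, Fin (t i), s = ⟨i, ⟨c, hc⟩⟩ →
        z s.1 (Fin.castLE (hle s.1) s.2) = z i c := by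
      rintro _ rfl
      rfl
    exact haux _ (σ.apply_symm_apply _)
  rw [hupd, ← cramer_apply, cramer_eq_adjugate_mulVec, mulVec_mulVec, adjugate_mul,
    smul_mulVec, one_mulVec, Pi.smul_apply, smul_eq_mul, hwp, mul_comm]

lemma det_blockDiagonal_sigma {t : Fin m → ℕ} (d : ∀ i, Matrix (Fin (t i)) (Fin (t i)) ℂ) :
    (blockDiagonal' d).det = ∏ i, (d i).det := by
  rw [(blockTriangular_blockDiagonal' d).det_fintype]
  refine Finset.prod_congr rfl fun i _ => ?_
  rw [← det_submatrix_equiv_self (Equiv.sigmaSubtype i).symm]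
  congr 1
  ext k l
  exact blockDiagonal'_apply_eq d i k l

/-- Behaviour of Ptolemy coordinates under left multiplication and under right multiplication
by upper triangular matrices. -/
lemma ptolemyCoord_mul_upperTriangular {t : Fin m → ℕ} (hs : ∑ i, t i = n)
    (a : Matrix (Fin n) (Fin n) ℂ) (g u : Fin m → Matrix (Fin n) (Fin n) ℂ)
    (hu : ∀ i, (u i).BlockTriangular id) :
    ptolemyCoord (fun i => a * g i * u i) t =
      a.det * ptolemyCoord g t *
        ∏ i, ∏ k : Fin (t i), u i (Fin.castLE (le_of_sum_eq hs i) k)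
          (Fin.castLE (le_of_sum_eq hs i) k) := by
  obtain ⟨σ, hσ⟩ := exists_equiv_ptolemyCoord_eq_det hs
  have hle := le_of_sum_eq hs
  let B : ∀ i, Matrix (Fin (t i)) (Fin (t i)) ℂ := fun i =>
    (u i).submatrix (Fin.castLE (hle i)) (Fin.castLE (hle i))
  have hB : ∀ i, (B i).det = ∏ k : Fin (t i), u i (Fin.castLE (hle i) k) (Fin.castLE (hle i) k) :=
    fun i => det_of_isUpperTriangular fun k l hkl => hu i (by simpa using hkl)
  have hfac : colsMat (fun i => a * g i * u i) t hle =
      a * colsMat g t hle * blockDiagonal' B := by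
    ext r p
    obtain ⟨j, k⟩ := p
    simp only [colsMat, of_apply]
    rw [mul_apply, mul_apply, Fintype.sum_sigma, Finset.sum_eq_single j]
    · simp only [blockDiagonal'_apply_eq]
      symm
      refine Fintype.sum_of_injective (Fin.castLE (hle j)) (Fin.castLE_injective _) _ _ ?_ ?_
      · intro l hl
        rw [hu j, mul_zero]
        by_contra! hlt
        simp only [id, Fin.le_def, Fin.val_castLE] at hlt
        exact hl ⟨⟨l, by have := k.2; omega⟩, rfl⟩
      · intro l
        simp [B, mul_apply]
    · intro i _ hij
      refine Finset.sum_eq_zero fun l _ => ?_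
      rw [blockDiagonal'_apply_ne _ _ _ hij, mul_zero]
    · simp
  rw [hσ, hσ, hfac, ← submatrix_mul_equiv (a * colsMat g t hle) (blockDiagonal' B) id σ σ,
    det_mul, det_submatrix_equiv_self, det_blockDiagonal_sigma]
  simp only [← hB]
  congr 1
  rw [← det_mul]
  rfl

end PtolemyDeterminant

section Unitriangular

variable {n : ℕ} {x y : Matrix (Fin n) (Fin n) ℂ}

lemma diag_mul_of_upperTriangular (hx : x.BlockTriangular id) (hy : y.BlockTriangular id)
    (i : Fin n) : (x * y) i i = x i i * y i i := by
  rw [mul_apply]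
  refine Finset.sum_eq_single i (fun j _ hj => ?_) (by simp)
  rcases lt_or_gt_of_ne hj with h | h
  · rw [hx h, zero_mul]
  · rw [hy h, mul_zero]

lemma IsUnitriangular.blockTriangular (hx : IsUnitriangular x) : x.BlockTriangular id :=
  fun i j hij => hx.2 i j hij

lemma IsUnitriangular.one : IsUnitriangular (1 : Matrix (Fin n) (Fin n) ℂ) :=
  ⟨fun _ => one_apply_eq _, fun _ _ h => one_apply_ne h.ne'⟩

lemma IsUnitriangular.mul (hx : IsUnitriangular x) (hy : IsUnitriangular y) :
    IsUnitriangular (x * y) :=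
  ⟨fun i => by
    rw [diag_mul_of_upperTriangular hx.blockTriangular hy.blockTriangular, hx.1, hy.1, mul_one],
    fun _ _ h => (hx.blockTriangular.mul hy.blockTriangular) h⟩

lemma IsUnitriangular.det_eq_one (hx : IsUnitriangular x) : x.det = 1 := by
  rw [det_of_isUpperTriangular hx.blockTriangular]
  exact Finset.prod_eq_one fun i _ => hx.1 i

lemma upperTriangular_inv (hx : x.BlockTriangular id) (hdet : IsUnit x.det) :
    x⁻¹.BlockTriangular id := by
  have := x.invertibleOfIsUnitDet hdet
  exact blockTriangular_inv_of_blockTriangular hx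

lemma IsUnitriangular.inv (hx : IsUnitriangular x) : IsUnitriangular x⁻¹ := by
  have hdet : IsUnit x.det := by simp [hx.det_eq_one]
  have hinv := upperTriangular_inv hx.blockTriangular hdet
  refine ⟨fun i => ?_, fun _ _ h => hinv h⟩
  have := diag_mul_of_upperTriangular hx.blockTriangular hinv i
  rw [mul_nonsing_inv _ hdet, one_apply_eq, hx.1, one_mul] at this
  exact this.symm

/-- Right multiplication by unitriangular matrices and left multiplication by a matrix of
determinant one leave Ptolemy coordinates unchanged. -/
lemma ptolemyCoord_mul_unitriangular {m : ℕ} {t : Fin m → ℕ} (hs : ∑ i, t i = n)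
    {a : Matrix (Fin n) (Fin n) ℂ} (ha : a.det = 1) (g : Fin m → Matrix (Fin n) (Fin n) ℂ)
    {u : Fin m → Matrix (Fin n) (Fin n) ℂ} (hu : ∀ i, IsUnitriangular (u i)) :
    ptolemyCoord (fun i => a * g i * u i) t = ptolemyCoord g t := by
  rw [ptolemyCoord_mul_upperTriangular hs a g u fun i => (hu i).blockTriangular, ha, one_mul]
  simp [fun i => (hu i).1]

end Unitriangular

section Flags

variable {n m : ℕ}

lemma sum_single_add_single_add_single (p q i : Fin m) (a b c : ℕ) :
    ∑ j, (Pi.single p a + Pi.single q b + Pi.single i c : Fin m → ℕ) j = a + b + c := by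
  simp [Finset.sum_add_distrib]

/-- If the flags of `x i` and `y i` share their first `c` columns and all Ptolemy coordinates
agree, then the next columns differ by a combination of those first `c` columns. -/
lemma exists_col_eq_add_mulVec {x y : Fin m → Matrix (Fin n) (Fin n) ℂ} {p q i : Fin m}
    (hpq : p ≠ q) (hpi : p ≠ i) (hqi : q ≠ i) (hxy : ∀ j, j ≠ i → y j = x j)
    (hne : ∀ a b c, a + b + c = n →
      ptolemyCoord x (Pi.single p a + Pi.single q b + Pi.single i c) ≠ 0)
    (heq : ∀ a b c, a + b + c = n →
      ptolemyCoord y (Pi.single p a + Pi.single q b + Pi.single i c) =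
        ptolemyCoord x (Pi.single p a + Pi.single q b + Pi.single i c))
    (c : Fin n) (hc : ∀ k < c, ∀ r, y i r k = x i r k) :
    ∃ z : Fin n → ℂ, (∀ k, c ≤ k → z k = 0) ∧ (y i).col c = (x i).col c + x i *ᵥ z := by
  have key : ∀ a b, a + b + (c + 1) = n → ∃ z : Fin m → Fin n → ℂ,
      (∀ j (k : Fin n),
        (Pi.single p a + Pi.single q b + Pi.single i (c : ℕ) : Fin m → ℕ) j ≤ (k : ℕ) →
        z j k = 0) ∧ ∑ j, x j *ᵥ z j = (y i).col c - (x i).col c := by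
    intro a b hab
    have hs := (sum_single_add_single_add_single p q i a b (c + 1)).trans hab
    obtain ⟨z, hz, hsum⟩ := exists_sum_mulVec_eq hs (hne a b _ hab) ((y i).col c)
    have hcr := ptolemyCoord_eq_mul_of_col_eq hs (x := x) (y := y) (i := i) (c := c)
      (by simp [hpi.symm, hqi.symm]) (fun j k hk hjk r => by
        by_cases hj : j = i
        · subst hj
          refine hc k (lt_of_le_of_ne ?_ fun h => hjk ⟨rfl, h⟩) r
          simp [hpi.symm, hqi.symm] at hk
          exact Fin.le_def.2 (by omega)
        · rw [hxy j hj]) hz hsum.symm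
    rw [heq a b _ hab] at hcr
    have hz1 : z i c = 1 := (mul_eq_right₀ (hne a b _ hab)).1 hcr.symm
    refine ⟨z - Pi.single i (Pi.single c 1), fun j k hk => ?_, ?_⟩
    · by_cases hj : j = i
      · subst hj
        by_cases hkc : k = c
        · simp [hkc, hz1]
        · have : (k : ℕ) ≠ c := fun h => hkc (Fin.ext h)
          simp [hpi.symm, hqi.symm] at hk
          have := hz j k (by simp [hpi.symm, hqi.symm]; omega)
          simp [this, hkc]
      · have := hz j k (by simpa [hj] using hk)
        simp [this, hj]
    · simp only [Pi.sub_apply, mulVec_sub, Finset.sum_sub_distrib, hsum]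
      rw [Finset.sum_eq_single i (fun j _ hj => by simp [hj]) (by simp)]
      simp
  have descend : ∀ e b, e + b + (c + 1) = n → ∃ z : Fin m → Fin n → ℂ,
      (∀ j (k : Fin n),
        (Pi.single p 0 + Pi.single q b + Pi.single i (c : ℕ) : Fin m → ℕ) j ≤ (k : ℕ) →
        z j k = 0) ∧ ∑ j, x j *ᵥ z j = (y i).col c - (x i).col c := by
    intro e
    induction e with
    | zero => exact fun b hb => key 0 b hb
    | succ e ih =>
      intro b hb
      obtain ⟨z, hz, hsum⟩ := ih (b + 1) (by omega)
      obtain ⟨w, hw, hsum'⟩ := key (e + 1) b hb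
      have htot : e + 1 + (b + 1) + c = n := by omega
      have h0 := eq_zero_of_sum_mulVec_eq_zero (z := z - w)
        ((sum_single_add_single_add_single p q i (e + 1) (b + 1) c).trans htot)
        (hne _ _ _ htot) (fun j k hjk => by
          simp only [Pi.add_apply, Pi.single_apply] at hjk hz hw
          rw [Pi.sub_apply, Pi.sub_apply, hz j k (by split_ifs at hjk ⊢ <;> omega),
            hw j k (by split_ifs at hjk ⊢ <;> omega), sub_zero])
        (by simp [mulVec_sub, hsum, hsum'])
      have hzw : z = w := sub_eq_zero.1 h0
      refine ⟨z, fun j k hjk => ?_, hsum⟩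
      by_cases hj : j = p
      · subst hj
        exact hz j k (by simp [hpq, hpi])
      · rw [hzw]
        exact hw j k (by simpa [hj] using hjk)
  obtain ⟨z, hz, hsum⟩ := descend (n - (c + 1)) 0 (by have := c.2; omega)
  refine ⟨z i, fun k hk => hz i k (by simpa using hk), ?_⟩
  rw [Finset.sum_eq_single i (fun j _ hj => ?_) (by simp)] at hsum
  · rw [hsum]; abel
  · have : z j = 0 := funext fun k => hz j k (by simp [hj])
    rw [this, mulVec_zero]

/-- Given two fixed flags in general position, a third one is determined by the Ptolemy
coordinates of the triple. -/
lemma exists_unitriangular_of_ptolemyCoord_eq {x y : Fin m → Matrix (Fin n) (Fin n) ℂ}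
    {p q i : Fin m} (hpq : p ≠ q) (hpi : p ≠ i) (hqi : q ≠ i) (hxy : ∀ j, j ≠ i → y j = x j)
    (hne : ∀ a b c, a + b + c = n →
      ptolemyCoord x (Pi.single p a + Pi.single q b + Pi.single i c) ≠ 0)
    (heq : ∀ a b c, a + b + c = n →
      ptolemyCoord y (Pi.single p a + Pi.single q b + Pi.single i c) =
        ptolemyCoord x (Pi.single p a + Pi.single q b + Pi.single i c)) :
    ∃ u, IsUnitriangular u ∧ y i = x i * u := by
  have step : ∀ c, c ≤ n → ∃ u : Matrix (Fin n) (Fin n) ℂ, IsUnitriangular u ∧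
      ∀ k : Fin n, (k : ℕ) < c → ∀ r, y i r k = (x i * u) r k := by
    intro c
    induction c with
    | zero => exact fun _ => ⟨1, .one, by simp⟩
    | succ c ih =>
      intro hcn
      obtain ⟨u, hu, hcols⟩ := ih (by omega)
      let x' : Fin m → Matrix (Fin n) (Fin n) ℂ := Function.update x i (x i * u)
      have hx' : x' = fun j => 1 * x j * (Function.update (fun _ => 1) i u : Fin m → _) j := by
        funext j
        by_cases hj : j = i
        · subst hj; simp [x']
        · simp [x', hj]
      have hinv : ∀ a b c, a + b + c = n →
          ptolemyCoord x' (Pi.single p a + Pi.single q b + Pi.single i c) =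
            ptolemyCoord x (Pi.single p a + Pi.single q b + Pi.single i c) := by
        intro a b c habc
        rw [hx']
        refine ptolemyCoord_mul_unitriangular
          ((sum_single_add_single_add_single p q i a b c).trans habc) det_one x fun j => ?_
        by_cases hj : j = i
        · subst hj; simpa using hu
        · simpa [hj] using IsUnitriangular.one
      obtain ⟨z, hz, hcol⟩ := exists_col_eq_add_mulVec (x := x') (y := y) hpq hpi hqi
        (fun j hj => by simp [x', hj, hxy j hj])
        (fun a b c habc => by rw [hinv a b c habc]; exact hne a b c habc)
        (fun a b c habc => by rw [hinv a b c habc]; exact heq a b c habc) ⟨c, hcn⟩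
        (fun k hk r => by simpa [x'] using hcols k hk r)
      let w : Matrix (Fin n) (Fin n) ℂ := (1 : Matrix (Fin n) (Fin n) ℂ).updateCol ⟨c, hcn⟩
        (Pi.single ⟨c, hcn⟩ 1 + z)
      have hw : IsUnitriangular w := by
        refine ⟨fun k => ?_, fun k l hkl => ?_⟩
        · by_cases hk : k = ⟨c, hcn⟩
          · subst hk; simp [w, hz]
          · simp [w, updateCol_ne hk]
        · by_cases hl : l = ⟨c, hcn⟩
          · subst hl; simp [w, hz k hkl.le, hkl.ne']
          · simp [w, updateCol_ne hl, hkl.ne']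
      refine ⟨u * w, hu.mul hw, fun k hk r => ?_⟩
      rw [← Matrix.mul_assoc]
      by_cases hkc : k = ⟨c, hcn⟩
      · subst hkc
        have h1 := congrFun hcol r
        have h2 : (x i * u * w) r ⟨c, hcn⟩ =
            ((x i * u) *ᵥ (Pi.single ⟨c, hcn⟩ 1 + z)) r := by
          simp [mul_apply, mulVec, dotProduct, w]
        rw [h2, mulVec_add]
        simpa [x'] using h1
      · have hk' : (k : ℕ) ≠ c := fun h => hkc (Fin.ext h)
        rw [hcols k (by omega) r, mul_apply (M := x i * u)]
        simp [w, updateCol_ne hkc, one_apply]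
  obtain ⟨u, hu, h⟩ := step n le_rfl
  exact ⟨u, hu, Matrix.ext fun r k => h k k.2 r⟩

/-- A basis adapted to two flags in general position: it is obtained from the first flag by a
unitriangular matrix, and from the second one by a triangular matrix followed by a reversal. -/
lemma exists_adapted_basis {g : Fin m → Matrix (Fin n) (Fin n) ℂ} {p q : Fin m} (hpq : p ≠ q)
    (hgen : ∀ a b, a + b = n → ptolemyCoord g (Pi.single p a + Pi.single q b) ≠ 0) :
    ∃ v s : Matrix (Fin n) (Fin n) ℂ, IsUnitriangular v ∧ s.BlockTriangular id ∧
      g q * s = (g p * v).submatrix id Fin.rev := by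
  have hsum : ∀ a b, ∑ j, (Pi.single p a + Pi.single q b : Fin m → ℕ) j = a + b := by
    simp [Finset.sum_add_distrib]
  have hex : ∀ j : Fin n, ∃ z₀ z₁ : Fin n → ℂ, (∀ k, j ≤ k → z₀ k = 0) ∧
      (∀ k : Fin n, n - j ≤ (k : ℕ) → z₁ k = 0) ∧
      (g p).col j = g p *ᵥ z₀ + g q *ᵥ z₁ := by
    intro j
    have hj : (j : ℕ) + (n - j) = n := by have := j.2; omega
    obtain ⟨z, hz, h⟩ := exists_sum_mulVec_eq ((hsum _ _).trans hj) (hgen _ _ hj) ((g p).col j)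
    refine ⟨z p, z q, fun k hk => hz p k (by simpa [hpq] using hk),
      fun k hk => hz q k (by simpa [hpq.symm] using hk), ?_⟩
    rw [← h, Fintype.sum_eq_add p q hpq]
    rintro l ⟨hl, hl'⟩
    have : z l = 0 := funext fun k => hz l k (by simp [hl, hl'])
    rw [this, mulVec_zero]
  choose z₀ z₁ h₀ h₁ hcol using hex
  refine ⟨of fun k j => (Pi.single j 1 - z₀ j : Fin n → ℂ) k, of fun k j => z₁ j.rev k,
    ⟨fun i => ?_, fun i j hij => ?_⟩, fun i j hij => ?_, ?_⟩
  · simp [h₀]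
  · simp [h₀ j i hij.le, hij.ne']
  · refine h₁ _ _ ?_
    simp only [id, Fin.lt_def] at hij
    rw [Fin.val_rev]
    omega
  · ext r j
    have h2 : (g p * of fun k j => (Pi.single j 1 - z₀ j : Fin n → ℂ) k) r j.rev =
        (g p *ᵥ (Pi.single j.rev 1 - z₀ j.rev)) r := rfl
    have h3 : (g q * of fun k j => z₁ j.rev k) r j = (g q *ᵥ z₁ j.rev) r := rfl
    rw [submatrix_apply, id, h2, h3, mulVec_sub, mulVec_single_one, hcol]
    simp

/-- Two pairs of flags in general position with equal Ptolemy coordinates are related by a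
matrix of determinant one. -/
lemma exists_det_one_of_pair {g h : Fin m → Matrix (Fin n) (Fin n) ℂ} {p q : Fin m}
    (hpq : p ≠ q) (hg : ∀ i, (g i).det = 1) (hh : ∀ i, (h i).det = 1)
    (hgen : ∀ a b, a + b = n → ptolemyCoord g (Pi.single p a + Pi.single q b) ≠ 0)
    (heq : ∀ a b, a + b = n → ptolemyCoord g (Pi.single p a + Pi.single q b) =
      ptolemyCoord h (Pi.single p a + Pi.single q b)) :
    ∃ a u₀ u₁ : Matrix (Fin n) (Fin n) ℂ, a.det = 1 ∧ IsUnitriangular u₀ ∧ IsUnitriangular u₁ ∧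
      h p = a * g p * u₀ ∧ h q = a * g q * u₁ := by
  obtain ⟨v, s, hv, hs, hvs⟩ := exists_adapted_basis hpq hgen
  obtain ⟨v', s', hv', hs', hvs'⟩ := exists_adapted_basis (g := h) hpq
    fun a b hab => heq a b hab ▸ hgen a b hab
  have det_unit : ∀ {x y v s : Matrix (Fin n) (Fin n) ℂ}, x.det = 1 → IsUnitriangular v →
      y * s = (x * v).submatrix id Fin.rev → IsUnit s.det := by
    intro x y v s hx hv hys
    have h1 : IsUnit (y * s) := by
      rw [hys]
      have : IsUnit (x * v) := by simp [isUnit_iff_isUnit_det, hx, hv.det_eq_one]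
      exact (isUnit_submatrix_equiv (e₁ := Equiv.refl _) (e₂ := Fin.revPerm)).2 this
    rw [isUnit_iff_isUnit_det, det_mul] at h1
    exact isUnit_of_mul_isUnit_right h1
  have hsd := det_unit (hg p) hv hvs
  have hsd' := det_unit (hh p) hv' hvs'
  have hvd' : IsUnit v'.det := by simp [hv'.det_eq_one]
  have hgv : IsUnit (g p * v).det := by simp [hg, hv.det_eq_one]
  let a := h p * v' * (g p * v)⁻¹
  have ha : a.det = 1 := by
    simp [a, det_nonsing_inv, hg, hh, hv.det_eq_one, hv'.det_eq_one]
  have hav : a * (g p * v) = h p * v' := by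
    simp only [a]
    rw [Matrix.mul_assoc, nonsing_inv_mul _ hgv, Matrix.mul_one]
  have has : a * (g q * s) = h q * s' := by
    rw [hvs, hvs', ← hav]
    rfl
  have hP : h p = a * g p * (v * v'⁻¹) := by
    rw [← Matrix.mul_assoc, Matrix.mul_assoc a, hav, Matrix.mul_assoc, mul_nonsing_inv _ hvd',
      Matrix.mul_one]
  have hQ : h q = a * g q * (s * s'⁻¹) := by
    rw [← Matrix.mul_assoc, Matrix.mul_assoc a, has, Matrix.mul_assoc, mul_nonsing_inv _ hsd',
      Matrix.mul_one]
  have hU₀ : IsUnitriangular (v * v'⁻¹) := hv.mul hv'.inv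
  have hU : (s * s'⁻¹).BlockTriangular id := hs.mul (upperTriangular_inv hs' hsd')
  set U := s * s'⁻¹
  set U₀ := v * v'⁻¹
  have hprod : ∀ b (hb : b ≤ n), ∏ k : Fin b, U (Fin.castLE hb k) (Fin.castLE hb k) = 1 := by
    intro b hb
    have hab : n - b + b = n := Nat.sub_add_cancel hb
    have hsum : ∑ j, (Pi.single p (n - b) + Pi.single q b : Fin m → ℕ) j = n := by
      simp [Finset.sum_add_distrib, hab]
    let u : Fin m → Matrix (Fin n) (Fin n) ℂ := Function.update (fun _ => U₀) q U
    have hu : ∀ i, (u i).BlockTriangular id := by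
      intro i
      by_cases hi : i = q
      · subst hi; simpa [u] using hU
      · simpa [u, hi] using hU₀.blockTriangular
    have h1 := ptolemyCoord_mul_upperTriangular hsum a g u hu
    have h2 : ptolemyCoord (fun i => a * g i * u i) (Pi.single p (n - b) + Pi.single q b) =
        ptolemyCoord h (Pi.single p (n - b) + Pi.single q b) := by
      refine ptolemyCoord_congr hsum fun j k hk r => ?_
      by_cases hj : j = q
      · subst hj; simp [u, ← hQ]
      · by_cases hj' : j = p
        · subst hj'; simp [u, hj, ← hP]
        · simp [hj, hj'] at hk
    rw [h2, ← heq _ _ hab, ha, one_mul, eq_comm, mul_eq_left₀ (hgen _ _ hab),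
      Finset.prod_eq_single q (fun i _ hi => by simp [u, hi, hU₀.1]) (by simp)] at h1
    have hb' : (Pi.single p (n - b) + Pi.single q b : Fin m → ℕ) q = b := by simp [hpq.symm]
    rw [← h1, ← (finCongr hb').prod_comp]
    simp only [u, Function.update_self]
    rfl
  refine ⟨a, U₀, U, ha, hU₀, ⟨fun k => ?_, fun _ _ hij => hU hij⟩, hP, hQ⟩
  have h1 := hprod (k + 1) k.2
  rw [Fin.prod_univ_castSucc] at h1
  have h2 := hprod k k.2.le
  have h3 : ∏ l : Fin (k : ℕ), U (Fin.castLE k.2 l.castSucc) (Fin.castLE k.2 l.castSucc) = 1 := h2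
  rw [h3, one_mul] at h1
  exact h1

end Flags

/-- a generic tuple is determined up to the diagonal `SL(n, ℂ)`-action by its
Ptolemy coordinates: if two generic tuples `(g₀, …, g_k)` and `(h₀, …, h_k)` in `SL(n, ℂ)`
have the same (everywhere nonzero) Ptolemy coordinates, then there is `g ∈ SL(n, ℂ)` and
upper unitriangular matrices `u₀, …, u_k` with `h i = g · g i · u i` for all `i`. -/
theorem generic_tuple_determined_by_ptolemy (n k : ℕ) (hn : 2 ≤ n) (hk : 1 ≤ k)
    (g h : Fin (k + 1) → Matrix.SpecialLinearGroup (Fin n) ℂ)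
    (hgen_g : ∀ t : Fin (k + 1) → ℕ, ∑ i, t i = n →
      ptolemyCoord (fun i => (g i : Matrix (Fin n) (Fin n) ℂ)) t ≠ 0)
    (hgen_h : ∀ t : Fin (k + 1) → ℕ, ∑ i, t i = n →
      ptolemyCoord (fun i => (h i : Matrix (Fin n) (Fin n) ℂ)) t ≠ 0)
    (heq : ∀ t : Fin (k + 1) → ℕ, ∑ i, t i = n →
      ptolemyCoord (fun i => (g i : Matrix (Fin n) (Fin n) ℂ)) t =
        ptolemyCoord (fun i => (h i : Matrix (Fin n) (Fin n) ℂ)) t) :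
    ∃ (a : Matrix.SpecialLinearGroup (Fin n) ℂ) (u : Fin (k + 1) → Matrix (Fin n) (Fin n) ℂ),
      (∀ i, IsUnitriangular (u i)) ∧
      ∀ i, (h i : Matrix (Fin n) (Fin n) ℂ) =
        (a : Matrix (Fin n) (Fin n) ℂ) * (g i : Matrix (Fin n) (Fin n) ℂ) * u i := by
  have h01 : (0 : Fin (k + 1)) ≠ 1 := by
    obtain ⟨k, rfl⟩ : ∃ l, k = l + 1 := ⟨k - 1, by omega⟩
    exact Fin.zero_ne_one
  have hsum2 : ∀ a b, a + b = n →
      ∑ j, (Pi.single 0 a + Pi.single 1 b : Fin (k + 1) → ℕ) j = n := by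
    rintro a b rfl
    simp [Finset.sum_add_distrib]
  obtain ⟨a, u₀, u₁, ha, hu₀, hu₁, h0, h1⟩ := exists_det_one_of_pair
    (g := fun i => (g i : Matrix (Fin n) (Fin n) ℂ))
    (h := fun i => (h i : Matrix (Fin n) (Fin n) ℂ)) h01 (fun i => (g i).2) (fun i => (h i).2)
    (fun a b hab => hgen_g _ (hsum2 a b hab)) (fun a b hab => heq _ (hsum2 a b hab))
  have hex : ∀ i, ∃ u, IsUnitriangular u ∧ (h i : Matrix (Fin n) (Fin n) ℂ) =
      a * (g i : Matrix (Fin n) (Fin n) ℂ) * u := by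
    intro i
    by_cases hi0 : i = 0
    · exact ⟨u₀, hu₀, hi0 ▸ h0⟩
    by_cases hi1 : i = 1
    · exact ⟨u₁, hu₁, hi1 ▸ h1⟩
    let x : Fin (k + 1) → Matrix (Fin n) (Fin n) ℂ := fun j => a * (g j).1
    let y : Fin (k + 1) → Matrix (Fin n) (Fin n) ℂ := Function.update x i (h i).1
    let u : Fin (k + 1) → Matrix (Fin n) (Fin n) ℂ :=
      Function.update (Function.update (fun _ => 1) 1 u₁) 0 u₀
    have hu : ∀ j, IsUnitriangular (u j) := by
      intro j
      by_cases hj0 : j = 0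
      · subst hj0; simpa [u] using hu₀
      by_cases hj1 : j = 1
      · subst hj1; simpa [u, hj0] using hu₁
      · simpa [u, hj0, hj1] using IsUnitriangular.one
    have hx : ∀ t : Fin (k + 1) → ℕ, ∑ j, t j = n →
        ptolemyCoord x t = ptolemyCoord (fun j => (g j).1) t := by
      intro t ht
      have := ptolemyCoord_mul_unitriangular ht ha (fun j => (g j).1)
        (u := fun _ => 1) fun _ => .one
      simpa [x] using this
    have hs3 := fun b c d (hbcd : b + c + d = n) =>
      (sum_single_add_single_add_single (0 : Fin (k + 1)) 1 i b c d).trans hbcd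
    obtain ⟨w, hw, hyw⟩ := exists_unitriangular_of_ptolemyCoord_eq (x := x) (y := y) (i := i) h01
      (Ne.symm hi0) (Ne.symm hi1) (fun j hj => by simp [y, hj])
      (fun b c d hbcd => by
        rw [hx _ (hs3 b c d hbcd)]
        exact hgen_g _ (hs3 b c d hbcd))
      (fun b c d hbcd => by
        have hs := hs3 b c d hbcd
        rw [hx _ hs]
        refine Eq.trans ?_ (heq _ hs).symm
        rw [← ptolemyCoord_mul_unitriangular hs det_one y hu]
        refine ptolemyCoord_congr hs fun j l hl r => ?_
        by_cases hj0 : j = 0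
        · subst hj0; simp [u, y, x, Ne.symm hi0, h0]
        by_cases hj1 : j = 1
        · subst hj1; simp [u, y, x, Ne.symm hi1, hj0, h1]
        by_cases hji : j = i
        · subst hji; simp [u, y, hi0, hi1]
        · simp [hj0, hj1, hji] at hl)
    exact ⟨w, hw, by simpa [y, x] using hyw⟩
  choose u hu hhu using hex
  exact ⟨⟨a, ha⟩, u, hu, hhu⟩
end

section
/- Let n ≥ 2, k ≥ 1, and let (g_0,…,g_k) be a tuple of matrices in SL(n,ℂ) all of whose Ptolemy coordinates are nonzero. If g ∈ SL(n,ℂ) is such that for each i ∈ {0,…,k} there exists an upper unitriangular matrix u_i with g·g_i = g_i·u_i, then g is the identity matrix. (The diagonal SL(n,ℂ)-action on generic (k+1)-tuples of cosets of the unipotent group is free for k ≥ 1.) -/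
/-- The `j`-th column of `A`, read as `0` if `j` is past the last column. -/
def Matrix.paddedCol {n : ℕ} (A : Matrix (Fin n) (Fin n) ℂ) (j : ℕ) : Fin n → ℂ :=
  fun r => if h : j < n then A r ⟨j, h⟩ else 0

/-- The span of the first `p` columns of `A`, where columns past the last are read as `0`. -/
def Matrix.leadingColSpan {n : ℕ} (A : Matrix (Fin n) (Fin n) ℂ) (p : ℕ) :
    Submodule ℂ (Fin n → ℂ) :=
  Submodule.span ℂ (Set.range fun j : Fin p => A.paddedCol j)

namespace Matrix

variable {n : ℕ} (A : Matrix (Fin n) (Fin n) ℂ)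

lemma mem_leadingColSpan {p j : ℕ} (hj : j < p) :
    A.paddedCol j ∈ A.leadingColSpan p :=
  Submodule.subset_span ⟨⟨j, hj⟩, rfl⟩

lemma col_mem_leadingColSpan {p : ℕ} (j : Fin n) (hj : (j : ℕ) < p) :
    A.col j ∈ A.leadingColSpan p := by
  convert A.mem_leadingColSpan hj using 1
  ext r
  simp [col, paddedCol]

lemma leadingColSpan_zero : A.leadingColSpan 0 = ⊥ := by
  simp [leadingColSpan]

lemma leadingColSpan_mono : Monotone A.leadingColSpan := by
  intro p q hpq
  refine Submodule.span_le.2 ?_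
  rintro _ ⟨j, rfl⟩
  exact A.mem_leadingColSpan (j.2.trans_le hpq)

lemma finrank_leadingColSpan_le (p : ℕ) : Module.finrank ℂ (A.leadingColSpan p) ≤ p :=
  (finrank_range_le_card (R := ℂ) fun j : Fin p => A.paddedCol j).trans_eq (Fintype.card_fin p)

end Matrix

lemma iSup_leadingColSpan_eq_top {n m : ℕ} {g : Fin m → Matrix (Fin n) (Fin n) ℂ}
    {t : Fin m → ℕ} (h : ptolemyCoord g t ≠ 0) : ⨆ i, (g i).leadingColSpan (t i) = ⊤ := by
  unfold ptolemyCoord at h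
  split_ifs at h with ht
  · rw [eq_top_iff]
    have hunit := (Matrix.isUnit_iff_isUnit_det _).2 (isUnit_iff_ne_zero.2 h)
    have hrange := LinearMap.range_eq_top.2
      (show Function.Surjective (Matrix.mulVecLin _) from
        Matrix.mulVec_surjective_iff_isUnit.2 hunit)
    rw [← hrange, Matrix.range_mulVecLin, Submodule.span_le]
    rintro _ ⟨c, rfl⟩
    have hmem := List.get_mem (ptolemyCols g t) (Fin.cast ht.symm c)
    simp only [ptolemyCols, List.mem_flatMap, List.mem_map, List.mem_range] at hmem
    obtain ⟨i, -, j, hj, hcol⟩ := hmem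
    have hpad : (g i).paddedCol j = (ptolemyCols g t).get (Fin.cast ht.symm c) := hcol
    refine Submodule.mem_iSup_of_mem i ?_
    change (ptolemyCols g t).get (Fin.cast ht.symm c) ∈ (g i).leadingColSpan (t i)
    exact hpad ▸ (g i).mem_leadingColSpan hj
  · exact absurd rfl h

lemma isCompl_leadingColSpan {n m : ℕ} {g : Fin m → Matrix (Fin n) (Fin n) ℂ} {i j : Fin m}
    (hij : i ≠ j) (hgen : ∀ t : Fin m → ℕ, ∑ l, t l = n → ptolemyCoord g t ≠ 0)
    {p q : ℕ} (hpq : p + q = n) :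
    IsCompl ((g i).leadingColSpan p) ((g j).leadingColSpan q) := by
  have hsup : (g i).leadingColSpan p ⊔ (g j).leadingColSpan q = ⊤ := by
    rw [eq_top_iff, ← iSup_leadingColSpan_eq_top (hgen (Pi.single i p + Pi.single j q)
      (by simp [Finset.sum_add_distrib, hpq]))]
    refine iSup_le fun l => ?_
    by_cases hi : l = i
    · subst hi
      simp [hij]
    · by_cases hj : l = j
      · subst hj
        simp [hi]
      · simp [hi, hj, Matrix.leadingColSpan_zero]
  refine ⟨disjoint_iff.2 ?_, codisjoint_iff.2 hsup⟩
  have hdim := Submodule.finrank_sup_add_finrank_inf_eq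
    ((g i).leadingColSpan p) ((g j).leadingColSpan q)
  rw [hsup, finrank_top, Module.finrank_fin_fun] at hdim
  have hp := (g i).finrank_leadingColSpan_le p
  have hq := (g j).finrank_leadingColSpan_le q
  exact Submodule.finrank_eq_zero.1 (by omega)

lemma IsUnitriangular.sub_one_mulVec_mem {n : ℕ} {a A u : Matrix (Fin n) (Fin n) ℂ}
    (hu : IsUnitriangular u) (h : a * A = A * u) {p : ℕ} {v : Fin n → ℂ}
    (hv : v ∈ A.leadingColSpan (p + 1)) :
    Matrix.mulVec (a - 1) v ∈ A.leadingColSpan p := by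
  suffices hle : A.leadingColSpan (p + 1) ≤
      (A.leadingColSpan p).comap (Matrix.mulVecLin (a - 1)) from hle hv
  refine Submodule.span_le.2 ?_
  rintro _ ⟨j, rfl⟩
  change Matrix.mulVec (a - 1) (A.paddedCol j) ∈ A.leadingColSpan p
  by_cases hj : (j : ℕ) < n
  · have hmul : (a - 1) * A = A * (u - 1) := by
      rw [sub_mul, mul_sub, h, one_mul, mul_one]
    have hcol : Matrix.mulVec (a - 1) (A.paddedCol j) =
        ∑ i, (u - 1) i ⟨j, hj⟩ • A.col i := by
      ext r
      have := congrFun (congrFun hmul r) ⟨j, hj⟩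
      simp only [Matrix.mul_apply] at this
      simpa [Matrix.mulVec, dotProduct, Matrix.paddedCol, hj, mul_comm] using this
    rw [hcol]
    refine Submodule.sum_mem _ fun i _ => ?_
    rcases lt_trichotomy (i : ℕ) j with hij | hij | hij
    · exact Submodule.smul_mem _ _ (A.col_mem_leadingColSpan i (by omega))
    · obtain rfl : i = ⟨j, hj⟩ := Fin.ext hij
      simp [hu.1]
    · have hne : i ≠ ⟨j, hj⟩ := fun he => by simp [he] at hij
      simp [hu.2 i ⟨j, hj⟩ hij, Matrix.one_apply_ne hne]
  · have hzero : A.paddedCol j = 0 := by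
      ext r
      simp [Matrix.paddedCol, hj]
    rw [hzero, Matrix.mulVec_zero]
    exact zero_mem _

/-- the diagonal `SL(n, ℂ)`-action on generic `(k+1)`-tuples of cosets of the
unipotent group is free for `k ≥ 1`: if `(g₀, …, g_k)` is a tuple in `SL(n, ℂ)` all of whose
Ptolemy coordinates are nonzero, and `a ∈ SL(n, ℂ)` is such that for each `i` there is an
upper unitriangular `u i` with `a · g i = g i · u i`, then `a = 1`. -/
theorem diagonal_action_free (n k : ℕ) (hn : 2 ≤ n) (hk : 1 ≤ k)
    (g : Fin (k + 1) → Matrix.SpecialLinearGroup (Fin n) ℂ)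
    (hgen : ∀ t : Fin (k + 1) → ℕ, ∑ i, t i = n →
      ptolemyCoord (fun i => (g i : Matrix (Fin n) (Fin n) ℂ)) t ≠ 0)
    (a : Matrix.SpecialLinearGroup (Fin n) ℂ)
    (hu : ∀ i, ∃ u : Matrix (Fin n) (Fin n) ℂ, IsUnitriangular u ∧
      (a : Matrix (Fin n) (Fin n) ℂ) * (g i : Matrix (Fin n) (Fin n) ℂ) =
        (g i : Matrix (Fin n) (Fin n) ℂ) * u) :
    a = 1 := by
  have hij : (⟨0, by omega⟩ : Fin (k + 1)) ≠ ⟨1, by omega⟩ := by simp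
  obtain ⟨u, hu₀, hau⟩ := hu ⟨0, by omega⟩
  obtain ⟨w, hw₁, haw⟩ := hu ⟨1, by omega⟩
  have hcompl {p q : ℕ} (hpq : p + q = n) := isCompl_leadingColSpan hij hgen hpq
  have hker (p : ℕ) (hp : p ≤ n) :
      ∀ v ∈ (g ⟨0, by omega⟩ : Matrix (Fin n) (Fin n) ℂ).leadingColSpan p,
        Matrix.mulVec ((a : Matrix (Fin n) (Fin n) ℂ) - 1) v = 0 := by
    induction p with
    | zero =>
      intro v hv
      rw [Matrix.leadingColSpan_zero, Submodule.mem_bot] at hv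
      rw [hv, Matrix.mulVec_zero]
    | succ p ih =>
      intro v hv
      obtain ⟨q, rfl⟩ := Nat.exists_eq_add_of_le hp
      obtain ⟨x, hx, y, hy, rfl⟩ := Submodule.mem_sup.1
        ((hcompl (p := p) (q := q + 1) (by omega)).sup_eq_top ▸ Submodule.mem_top (x := v))
      have hy' := (Submodule.add_mem_iff_right _
        (Matrix.leadingColSpan_mono _ p.le_succ hx)).1 hv
      rw [Matrix.mulVec_add, ih (by omega) x hx, zero_add]
      exact Submodule.disjoint_def.1 (hcompl (p := p + 1) (q := q) rfl).disjoint _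
        (Matrix.leadingColSpan_mono _ p.le_succ (hu₀.sub_one_mulVec_mem hau hy'))
        (hw₁.sub_one_mulVec_mem haw hy)
  have htop := (hcompl (p := n) (q := 0) rfl).sup_eq_top
  rw [Matrix.leadingColSpan_zero, sup_bot_eq] at htop
  refine Subtype.ext (sub_eq_zero.1 (Matrix.ext_of_mulVec_single fun i => ?_))
  rw [Matrix.zero_mulVec]
  exact hker n le_rfl _ (htop ▸ Submodule.mem_top)
end

section
/- Let n ≥ 2 and let c_{ij} ∈ ℂ∖{0} for 0 ≤ i < j ≤ 3 satisfy the single Ptolemy relation c_{03}·c_{12} + c_{01}·c_{23} = c_{02}·c_{13}. Define φ(t) = ∏_{0≤i<j≤3} c_{ij}^{t_i t_j} for t = (t_0,t_1,t_2,t_3) ∈ T^3(n). Then for every α ∈ T^3(n−2), the Ptolemy relations hold: φ(α_{03})·φ(α_{12}) + φ(α_{01})·φ(α_{23}) = φ(α_{02})·φ(α_{13}). -/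
/-- `φ(t) = ∏_{0 ≤ i < j ≤ 3} c_{ij} ^ (t_i t_j)`. -/
def phi (c : Fin 4 → Fin 4 → ℂ) (t : Fin 4 → ℕ) : ℂ :=
  ∏ p ∈ Finset.univ.filter (fun p : Fin 4 × Fin 4 => p.1 < p.2), c p.1 p.2 ^ (t p.1 * t p.2)

/-- The product defining `phi`, written out factor by factor. -/
theorem phi_eq (c : Fin 4 → Fin 4 → ℂ) (t : Fin 4 → ℕ) :
    phi c t = c 0 1 ^ (t 0 * t 1) * c 0 2 ^ (t 0 * t 2) * c 0 3 ^ (t 0 * t 3) *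
      c 1 2 ^ (t 1 * t 2) * c 1 3 ^ (t 1 * t 3) * c 2 3 ^ (t 2 * t 3) := by
  have hpairs : Finset.univ.filter (fun p : Fin 4 × Fin 4 => p.1 < p.2) =
      {(0, 1), (0, 2), (0, 3), (1, 2), (1, 3), (2, 3)} := by decide
  simp [phi, hpairs, mul_assoc]

/-- if the nonzero numbers `c_{ij}` (`0 ≤ i < j ≤ 3`) satisfy the single
Ptolemy relation `c₀₃ c₁₂ + c₀₁ c₂₃ = c₀₂ c₁₃`, then
`φ(t) = ∏_{i<j} c_{ij}^{t_i t_j}` satisfies the Ptolemy relations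
`φ(α₀₃) φ(α₁₂) + φ(α₀₁) φ(α₂₃) = φ(α₀₂) φ(α₁₃)` for every `α ∈ T³(n−2)`. -/
theorem phi_ptolemy_relations (n : ℕ) (hn : 2 ≤ n) (c : Fin 4 → Fin 4 → ℂ)
    (hc : ∀ i j : Fin 4, i < j → c i j ≠ 0)
    (hrel : c 0 3 * c 1 2 + c 0 1 * c 2 3 = c 0 2 * c 1 3) :
    ∀ α : Fin 4 → ℕ, (∑ i, α i) + 2 = n →
      phi c (vtx α 0 3) * phi c (vtx α 1 2) + phi c (vtx α 0 1) * phi c (vtx α 2 3) =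
        phi c (vtx α 0 2) * phi c (vtx α 1 3) := by
  intro α _
  simp [phi_eq, vtx]
  linear_combination (c 0 1 ^ (α 0 + α 1) * c 0 2 ^ (α 0 + α 2) * c 0 3 ^ (α 0 + α 3) *
    c 1 2 ^ (α 1 + α 2) * c 1 3 ^ (α 1 + α 3) * c 2 3 ^ (α 2 + α 3) *
    (c 0 1 ^ (α 0 * α 1) * c 0 2 ^ (α 0 * α 2) * c 0 3 ^ (α 0 * α 3) *
      c 1 2 ^ (α 1 * α 2) * c 1 3 ^ (α 1 * α 3) * c 2 3 ^ (α 2 * α 3)) ^ 2) * hrel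
end

section
/- Let n ≥ 2 be even, let σ_0, σ_1, σ_2, σ_3 ∈ {±1}, and let c assign a nonzero complex number c_t to each t ∈ T^3(n) such that the σ-twisted Ptolemy relations σ_2σ_3·c_{α_{03}}c_{α_{12}} + σ_0σ_3·c_{α_{01}}c_{α_{23}} = c_{α_{02}}c_{α_{13}} hold for every α ∈ T^3(n−2). Define c'_t = (−1)^{t_0 t_1}·c_t and set τ_0 = σ_0, τ_1 = σ_1, τ_2 = −σ_2, τ_3 = −σ_3. Then c' satisfies the τ-twisted Ptolemy relations: τ_2τ_3·c'_{α_{03}}c'_{α_{12}} + τ_0τ_3·c'_{α_{01}}c'_{α_{23}} = c'_{α_{02}}c'_{α_{13}} for every α ∈ T^3(n−2). -/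
/-- The coboundary-twisted assignment `c'_t = (−1)^{t₀ t₁} · c_t`. -/
def twist (c : (Fin 4 → ℕ) → ℂ) : (Fin 4 → ℕ) → ℂ :=
  fun t => (-1 : ℂ) ^ (t 0 * t 1) * c t

/-- let `n ≥ 2` be even, `σ₀, …, σ₃ ∈ {±1}`, and let `c` assign a nonzero
complex number to each `t ∈ T³(n)` satisfying the `σ`-twisted Ptolemy relations
`σ₂σ₃ c_{α₀₃} c_{α₁₂} + σ₀σ₃ c_{α₀₁} c_{α₂₃} = c_{α₀₂} c_{α₁₃}` for all `α ∈ T³(n−2)`.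
Then `c'_t = (−1)^{t₀ t₁} c_t` satisfies the `τ`-twisted Ptolemy relations, where
`τ₀ = σ₀`, `τ₁ = σ₁`, `τ₂ = −σ₂`, `τ₃ = −σ₃`. -/
theorem coboundary_action_on_ptolemy (n : ℕ) (hn : 2 ≤ n) (heven : Even n)
    (σ : Fin 4 → ℂ) (hσ : ∀ i, σ i = 1 ∨ σ i = -1)
    (c : (Fin 4 → ℕ) → ℂ) (hc : ∀ t : Fin 4 → ℕ, ∑ i, t i = n → c t ≠ 0)
    (hrel : ∀ α : Fin 4 → ℕ, (∑ i, α i) + 2 = n →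
      σ 2 * σ 3 * (c (vtx α 0 3) * c (vtx α 1 2)) +
        σ 0 * σ 3 * (c (vtx α 0 1) * c (vtx α 2 3)) = c (vtx α 0 2) * c (vtx α 1 3)) :
    ∀ α : Fin 4 → ℕ, (∑ i, α i) + 2 = n →
      (-σ 2) * (-σ 3) * (twist c (vtx α 0 3) * twist c (vtx α 1 2)) +
        σ 0 * (-σ 3) * (twist c (vtx α 0 1) * twist c (vtx α 2 3)) =
      twist c (vtx α 0 2) * twist c (vtx α 1 3) := by
  intro α hα
  have hsq : ((-1 : ℂ) ^ (α 0 * α 1)) ^ 2 = 1 := by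
    rw [← pow_mul, mul_comm, pow_mul]; norm_num
  have h03 : twist c (vtx α 0 3) * twist c (vtx α 1 2) =
      (-1) ^ (α 0 + α 1) * (c (vtx α 0 3) * c (vtx α 1 2)) := by
    simp only [twist]
    simp [vtx, add_mul, mul_add, pow_add]
    linear_combination (-1) ^ α 0 * (-1) ^ α 1 * (c (vtx α 0 3) * c (vtx α 1 2)) * hsq
  have h01 : twist c (vtx α 0 1) * twist c (vtx α 2 3) =
      -((-1) ^ (α 0 + α 1) * (c (vtx α 0 1) * c (vtx α 2 3))) := by
    simp only [twist]
    simp [vtx, add_mul, mul_add, pow_add]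
    linear_combination (-1) ^ α 0 * (-1) ^ α 1 * (c (vtx α 0 1) * c (vtx α 2 3)) * hsq
  have h02 : twist c (vtx α 0 2) * twist c (vtx α 1 3) =
      (-1) ^ (α 0 + α 1) * (c (vtx α 0 2) * c (vtx α 1 3)) := by
    simp only [twist]
    simp [vtx, add_mul, mul_add, pow_add]
    linear_combination (-1) ^ α 0 * (-1) ^ α 1 * (c (vtx α 0 2) * c (vtx α 1 3)) * hsq
  rw [h03, h01, h02]
  linear_combination (-1) ^ (α 0 + α 1) * hrel α hα
end

section
/- Let g, h be n×n complex matrices with det(g) = 1, and let 1 ≤ k ≤ n. Then the minor of the matrix g^{−1}h with rows {n−k+1,…,n} and columns {1,…,k} equals the determinant of the n×n matrix whose columns are, in order, the first n−k columns of g followed by the first k columns of h. -/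
theorem minor_eq_det_submatrix_s18 {n k : ℕ} (A : Matrix (Fin n) (Fin n) ℂ)
    {I J : Finset (Fin n)} (hI : I.card = k) (hJ : J.card = k) {r c : Fin k → Fin n}
    (hr : ∀ i, r i ∈ I) (hrm : StrictMono r) (hc : ∀ i, c i ∈ J) (hcm : StrictMono c) :
    minor A I J = (A.submatrix r c).det := by
  subst hI
  rw [minor, dif_pos hJ, Finset.orderEmbOfFin_unique rfl hr hrm,
    Finset.orderEmbOfFin_unique hJ hc hcm]

theorem ptolemyCols_pair {n : ℕ} (g h : Matrix (Fin n) (Fin n) ℂ) (a b : ℕ) :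
    ptolemyCols ![g, h] ![a, b] =
      (List.range a).map (fun j r => if hj : j < n then g r ⟨j, hj⟩ else 0) ++
        (List.range b).map (fun j r => if hj : j < n then h r ⟨j, hj⟩ else 0) := by
  simp [ptolemyCols, List.finRange_succ]

/-- The matrix whose columns are the first `m` columns of `g` followed by the first `k` columns
of `h`. -/
def joinCols {m k : ℕ} (g h : Matrix (Fin (m + k)) (Fin (m + k)) ℂ) :
    Matrix (Fin (m + k)) (Fin (m + k)) ℂ :=
  Matrix.of fun r => Fin.addCases (fun j : Fin m => g r (Fin.castAdd k j))
    (fun j : Fin k => h r ⟨j, by omega⟩)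

theorem ptolemyCoord_pair {m k : ℕ} (g h : Matrix (Fin (m + k)) (Fin (m + k)) ℂ) :
    ptolemyCoord ![g, h] ![m, k] = (joinCols g h).det := by
  have ht : (ptolemyCols ![g, h] ![m, k]).length = m + k := by
    simp [ptolemyCols_pair]
  rw [ptolemyCoord, dif_pos ht]
  congr 1
  ext r c
  induction c using Fin.addCases with
  | left j =>
    have hj : (j : ℕ) < m + k := by omega
    simp only [joinCols, Matrix.of_apply, Fin.addCases_left, List.get_eq_getElem, Fin.val_cast,
      Fin.val_castAdd, List.getElem_of_eq (ptolemyCols_pair g h m k)]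
    simp [hj]
    rfl
  | right j =>
    have hj : (j : ℕ) < m + k := by omega
    simp only [joinCols, Matrix.of_apply, Fin.addCases_right, List.get_eq_getElem, Fin.val_cast,
      Fin.val_natAdd, List.getElem_of_eq (ptolemyCols_pair g h m k)]
    simp [hj]

theorem det_mul_joinCols {m k : ℕ} (g h : Matrix (Fin (m + k)) (Fin (m + k)) ℂ)
    (hg : IsUnit g.det) :
    (g⁻¹ * joinCols g h).det =
      ((g⁻¹ * h).submatrix (Fin.natAdd m) fun j : Fin k => ⟨j, by omega⟩).det := by
  have hleft (i : Fin (m + k)) (j : Fin m) : (g⁻¹ * joinCols g h) i (Fin.castAdd k j) =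
      (1 : Matrix (Fin (m + k)) (Fin (m + k)) ℂ) i (Fin.castAdd k j) := by
    rw [← Matrix.nonsing_inv_mul g hg]
    simp [Matrix.mul_apply, joinCols]
  have hright (i : Fin (m + k)) (j : Fin k) : (g⁻¹ * joinCols g h) i (Fin.natAdd m j) =
      (g⁻¹ * h) i ⟨j, by omega⟩ := by
    simp [Matrix.mul_apply, joinCols]
  rw [← Matrix.det_submatrix_equiv_self finSumFinEquiv, ← Matrix.fromBlocks_toBlocks
    ((g⁻¹ * joinCols g h).submatrix finSumFinEquiv finSumFinEquiv)]
  have h11 : ((g⁻¹ * joinCols g h).submatrix finSumFinEquiv finSumFinEquiv).toBlocks₁₁ = 1 := by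
    ext i j
    simp [Matrix.toBlocks₁₁, hleft, Matrix.one_apply]
  have h21 : ((g⁻¹ * joinCols g h).submatrix finSumFinEquiv finSumFinEquiv).toBlocks₂₁ = 0 := by
    ext i j
    simp only [Matrix.toBlocks₂₁, Matrix.of_apply, Matrix.submatrix_apply,
      finSumFinEquiv_apply_left, finSumFinEquiv_apply_right, hleft, Matrix.zero_apply]
    refine Matrix.one_apply_ne fun e => ?_
    have := congrArg Fin.val e
    simp only [Fin.val_natAdd, Fin.val_castAdd] at this
    omega
  rw [h11, h21, Matrix.det_fromBlocks_zero₂₁, Matrix.det_one, one_mul]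
  congr 1
  ext i j
  simp [Matrix.toBlocks₂₂, hright]

/-- if `g, h` are `n × n` complex matrices with `det g = 1` and `1 ≤ k ≤ n`,
then the minor of `g⁻¹ h` with rows `{n−k+1, …, n}` and columns `{1, …, k}` (1-based; in
0-based form rows `{r | n − k ≤ r}` and columns `{c | c < k}`) equals the determinant of the
`n × n` matrix whose columns are, in order, the first `n−k` columns of `g` followed by the
first `k` columns of `h`. -/
theorem minor_eq_ptolemyCoord (n k : ℕ) (hk1 : 1 ≤ k) (hkn : k ≤ n)
    (g h : Matrix (Fin n) (Fin n) ℂ) (hg : g.det = 1) :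
    minor (g⁻¹ * h) (Finset.univ.filter fun r : Fin n => n - k ≤ (r : ℕ))
        (Finset.univ.filter fun c : Fin n => (c : ℕ) < k) =
      ptolemyCoord ![g, h] ![n - k, k] := by
  obtain ⟨m, rfl⟩ := Nat.exists_eq_add_of_le' hkn
  rw [Nat.add_sub_cancel, ptolemyCoord_pair]
  have hrm : StrictMono (Fin.natAdd m : Fin k → Fin (m + k)) := Fin.strictMono_natAdd m
  have hcm : StrictMono (fun j : Fin k => (⟨j, by omega⟩ : Fin (m + k))) := fun _ _ hij => hij
  have hI : (Finset.univ.filter fun r : Fin (m + k) => m ≤ (r : ℕ)) =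
      Finset.univ.image (Fin.natAdd m : Fin k → Fin (m + k)) := by
    ext r
    simp only [Finset.mem_filter, Finset.mem_univ, true_and, Finset.mem_image]
    refine ⟨fun hr => ⟨⟨r - m, by omega⟩, Fin.ext (Nat.add_sub_cancel' hr)⟩, ?_⟩
    rintro ⟨i, rfl⟩
    simp
  have hJ : (Finset.univ.filter fun c : Fin (m + k) => (c : ℕ) < k) =
      Finset.univ.image (fun j : Fin k => (⟨j, by omega⟩ : Fin (m + k))) := by
    ext c
    simp only [Finset.mem_filter, Finset.mem_univ, true_and, Finset.mem_image]
    refine ⟨fun hc => ⟨⟨c, hc⟩, rfl⟩, ?_⟩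
    rintro ⟨i, rfl⟩
    exact i.isLt
  rw [hI, hJ, minor_eq_det_submatrix_s18 (g⁻¹ * h)
    (by rw [Finset.card_image_of_injective _ hrm.injective, Finset.card_fin])
    (by rw [Finset.card_image_of_injective _ hcm.injective, Finset.card_fin])
    (fun i => Finset.mem_image_of_mem _ (Finset.mem_univ i)) hrm
    (fun i => Finset.mem_image_of_mem _ (Finset.mem_univ i)) hcm,
    ← det_mul_joinCols g h (by simp [hg]), Matrix.det_mul, Matrix.det_nonsing_inv, hg]
  simp
end
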